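/- Let n ≥ 2, 0 < α < 1, n−1 < d < n with nα > d, and let 1 < p < nα/d, with conjugate exponent p' = p/(p−1). Let U ⊆ ℝⁿ be open and bounded, and assume there is a constant C_U ≥ 1 such that for every r ∈ (0,1] the boundary ∂U can be covered by at most C_U·r^{−d} closed balls of radius r. Then there exists a constant C (depending only on n, α, d, p and U) such that for every continuously differentiable map u : ℝⁿ → ℝⁿ and every φ ∈ C^∞(ℝⁿ) with finite L^{p'}(ℝⁿ)-norm, one has |∫_U φ(u(x))·det(Du(x)) dx| ≤ C·‖φ‖_{L^{p'}(ℝⁿ)}·‖u‖_{C^{0,α}(U)}^{n/p}. -/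

import Mathlib

open MeasureTheory

/-- The `C^{0,α}(A)` Hölder norm of `f` on a set `A`:
`sup_{x ∈ A} ‖f x‖ + sup_{x ≠ y ∈ A} ‖f x - f y‖ / dist x y ^ α`. -/
noncomputable def holderNormOn {E F : Type*} [NormedAddCommGroup E] [NormedAddCommGroup F]
    (a : ℝ) (A : Set E) (f : E → F) : ℝ :=
  sSup ((fun x => ‖f x‖) '' A) +
    sSup {c : ℝ | ∃ x ∈ A, ∃ y ∈ A, x ≠ y ∧ c = ‖f x - f y‖ / dist x y ^ a}

section Simplex

variable {ι : Type*} [Fintype ι]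

/-- The corner simplex `{t | 0 ≤ t, ∑ t ≤ 1}`. -/
def cornerSimplex (ι : Type*) [Fintype ι] : Set (ι → ℝ) :=
  {t | (∀ i, 0 ≤ t i) ∧ ∑ i, t i ≤ 1}

/-- The corner simplex in `ℝ × (ι → ℝ)`. -/
def cornerSimplexProd (ι : Type*) [Fintype ι] : Set (ℝ × (ι → ℝ)) :=
  {q | 0 ≤ q.1 ∧ (∀ i, 0 ≤ q.2 i) ∧ q.1 + ∑ i, q.2 i ≤ 1}

lemma isClosed_cornerSimplex : IsClosed (cornerSimplex ι) := by
  have : cornerSimplex ι = (⋂ i, {t : ι → ℝ | 0 ≤ t i}) ∩ {t | ∑ i, t i ≤ 1} := by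
    ext t; simp [cornerSimplex]
  rw [this]
  refine (isClosed_iInter fun i => isClosed_le ?_ ?_).inter (isClosed_le ?_ ?_) <;> fun_prop

lemma isClosed_cornerSimplexProd : IsClosed (cornerSimplexProd ι) := by
  have : cornerSimplexProd ι = {q : ℝ × (ι → ℝ) | 0 ≤ q.1} ∩
      ((⋂ i, {q : ℝ × (ι → ℝ) | 0 ≤ q.2 i}) ∩ {q | q.1 + ∑ i, q.2 i ≤ 1}) := by
    ext t; simp [cornerSimplexProd]
  rw [this]
  refine (isClosed_le ?_ ?_).inter
    ((isClosed_iInter fun i => isClosed_le ?_ ?_).inter (isClosed_le ?_ ?_)) <;> fun_prop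

lemma cornerSimplex_subset_Icc : cornerSimplex ι ⊆ Set.Icc 0 1 := fun _ ht =>
  ⟨fun i => ht.1 i, fun i =>
    (Finset.single_le_sum (fun j _ => ht.1 j) (Finset.mem_univ i)).trans ht.2⟩

lemma isCompact_cornerSimplex : IsCompact (cornerSimplex ι) :=
  isCompact_Icc.of_isClosed_subset isClosed_cornerSimplex cornerSimplex_subset_Icc

lemma isCompact_cornerSimplexProd : IsCompact (cornerSimplexProd ι) := by
  refine (isCompact_Icc (a := (0 : ℝ × (ι → ℝ))) (b := 1)).of_isClosed_subset
    isClosed_cornerSimplexProd fun q hq => ?_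
  obtain ⟨h1, h2, h3⟩ := hq
  have h4 : ∀ i, q.2 i ≤ ∑ i, q.2 i := fun i =>
    Finset.single_le_sum (fun j _ => h2 j) (Finset.mem_univ i)
  have h5 : 0 ≤ ∑ i, q.2 i := Finset.sum_nonneg fun i _ => h2 i
  refine ⟨⟨h1, h2⟩, ⟨?_, fun i => ?_⟩⟩
  · simp only [Prod.fst_one]; linarith
  · have := h4 i
    simp only [Prod.snd_one, Pi.one_apply]; linarith

lemma volume_cornerSimplex_le_one : volume (cornerSimplex ι) ≤ 1 := by
  refine (measure_mono cornerSimplex_subset_Icc).trans ?_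
  simp [Real.volume_Icc_pi]

lemma volume_cornerSimplex_pos : 0 < volume (cornerSimplex ι) := by
  refine Measure.measure_pos_of_nonempty_interior _
    ⟨fun _ => 1 / (Fintype.card ι + 1 : ℝ), ?_⟩
  rw [mem_interior]
  refine ⟨{t | (∀ i, 0 < t i) ∧ ∑ i, t i < 1}, fun t ht => ⟨fun i => (ht.1 i).le, ht.2.le⟩, ?_, ?_⟩
  · have : {t : ι → ℝ | (∀ i, 0 < t i) ∧ ∑ i, t i < 1}
        = (⋂ i, {t : ι → ℝ | 0 < t i}) ∩ {t | ∑ i, t i < 1} := by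
      ext t; simp
    rw [this]
    refine (isOpen_iInter_of_finite fun i => isOpen_lt ?_ ?_).inter (isOpen_lt ?_ ?_) <;> fun_prop
  · refine ⟨fun i => by positivity, ?_⟩
    simp only [Finset.sum_const, Finset.card_univ, nsmul_eq_mul]
    rw [mul_one_div, div_lt_one (by positivity)]
    linarith

/-- An involutive affine map preserves Lebesgue measure. -/
lemma measurePreserving_of_involutive_affine {E : Type*} [NormedAddCommGroup E] [NormedSpace ℝ E]
    [MeasurableSpace E] [BorelSpace E] [FiniteDimensional ℝ E] (μ : Measure E)
    [μ.IsAddHaarMeasure] {T : E → E} (A : E →ₗ[ℝ] E) (c : E) (hT : ∀ x, T x = A x + c)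
    (hinv : Function.Involutive T) : MeasurePreserving T μ μ := by
  have hc : A c + c = 0 := by
    have := hinv 0
    simpa [hT] using this
  have hAA : A ∘ₗ A = LinearMap.id := by
    ext x
    have := hinv x
    rw [hT, hT, map_add, add_assoc, hc, add_zero] at this
    simpa using this
  have hdet : LinearMap.det A * LinearMap.det A = 1 := by
    rw [← LinearMap.det_comp, hAA, LinearMap.det_id]
  have habs : |(LinearMap.det A)⁻¹| = 1 := by
    rcases mul_self_eq_one_iff.mp hdet with h | h <;> simp [h]
  have hA : MeasurePreserving A μ μ := by
    refine ⟨A.continuous_of_finiteDimensional.measurable, ?_⟩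
    rw [Measure.map_linearMap_addHaar_eq_smul_addHaar μ (left_ne_zero_of_mul_eq_one hdet), habs]
    simp
  have : T = (fun x => x + c) ∘ A := by ext x; simp [hT]
  rw [this]
  exact (measurePreserving_add_right μ c).comp hA

lemma setIntegral_comp_involutive {E : Type*} [MeasurableSpace E] {μ : Measure E} {T : E → E}
    (hT : MeasurePreserving T μ μ) (hinv : Function.Involutive T) {s : Set E}
    (hs : ∀ x ∈ s, T x ∈ s) (g : E → ℝ) : ∫ x in s, g (T x) ∂μ = ∫ x in s, g x ∂μ := by
  have hpre : T ⁻¹' s = s := by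
    ext x
    exact ⟨fun hx => by simpa [hinv x] using hs _ hx, hs x⟩
  have hemb : MeasurableEmbedding T :=
    (MeasurableEquiv.mk ⟨T, T, hinv, hinv⟩ hT.measurable hT.measurable).measurableEmbedding
  have := hT.setIntegral_preimage_emb hemb g s
  rwa [hpre] at this

/-- The average of `φ` over the simplex with vertices `a` and `z j`, parametrised by the corner
simplex. -/
noncomputable def simplexAvg (φ : (ι → ℝ) → ℝ) (a : ι → ℝ) (z : ι → ι → ℝ) : ℝ :=
  ∫ t in cornerSimplex ι, φ (a + ∑ j, t j • (z j - a))

variable [DecidableEq ι]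

/-- The oriented integral of `φ` over the simplex with vertices `a` and `z j`. -/
noncomputable def simplexIntegral (φ : (ι → ℝ) → ℝ) (a : ι → ℝ) (z : ι → ι → ℝ) : ℝ :=
  (Matrix.of fun j => z j - a).det * simplexAvg φ a z

lemma sum_update_swap (z : ι → ι → ℝ) (a : ι → ℝ) (t : ι → ℝ) (s : ℝ) (j : ι) :
    t j • z j + ∑ i, Function.update t j s i • Function.update z j a i =
      s • a + ∑ i, t i • z i := by
  rw [← Finset.add_sum_erase _ _ (Finset.mem_univ j),
    ← Finset.add_sum_erase (a := j) _ (fun i => t i • z i) (Finset.mem_univ j)]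
  simp only [Function.update_self]
  have : ∀ i ∈ Finset.univ.erase j, Function.update t j s i • Function.update z j a i = t i • z i := by
    intro i hi
    have := Finset.ne_of_mem_erase hi
    simp [this]
  rw [Finset.sum_congr rfl this]
  abel

lemma sum_update_eq (t : ι → ℝ) (s : ℝ) (j : ι) :
    t j + ∑ i, Function.update t j s i = s + ∑ i, t i := by
  rw [← Finset.add_sum_erase _ _ (Finset.mem_univ j),
    ← Finset.add_sum_erase (a := j) _ (fun i => t i) (Finset.mem_univ j)]
  simp only [Function.update_self]
  have : ∀ i ∈ Finset.univ.erase j, Function.update t j s i = t i := by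
    intro i hi
    simp [Finset.ne_of_mem_erase hi]
  rw [Finset.sum_congr rfl this]
  abel

omit [DecidableEq ι] in
lemma simplexAvg_arg_eq (a : ι → ℝ) (z : ι → ι → ℝ) (t : ι → ℝ) :
    a + ∑ j, t j • (z j - a) = (1 - ∑ j, t j) • a + ∑ j, t j • z j := by
  simp only [smul_sub, Finset.sum_sub_distrib, sub_smul, one_smul, Finset.sum_smul]
  abel

lemma simplexAvg_swap (φ : (ι → ℝ) → ℝ) (a : ι → ℝ) (z : ι → ι → ℝ) (j : ι) :
    simplexAvg φ (z j) (Function.update z j a) = simplexAvg φ a z := by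
  set T : (ι → ℝ) → (ι → ℝ) := fun t => Function.update t j (1 - ∑ i, t i) with hTdef
  have hsum : ∀ t, ∑ i, T t i = 1 - t j := by
    intro t
    have := sum_update_eq t (1 - ∑ i, t i) j
    simp only [T]; linarith
  have hinv : Function.Involutive T := by
    intro t
    ext i
    by_cases h : i = j
    · subst h
      have := hsum t
      simp only [T] at this ⊢
      simp only [Function.update_self]
      rw [this]; ring
    · simp [T, h]
  let A : (ι → ℝ) →ₗ[ℝ] (ι → ℝ) :=
    { toFun := fun t => Function.update t j (-∑ i, t i)
      map_add' := by
        intro x y; ext i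
        by_cases h : i = j
        · subst h; simp [Finset.sum_add_distrib]; ring
        · simp [h]
      map_smul' := by
        intro c x; ext i
        by_cases h : i = j
        · subst h; simp [Finset.mul_sum]
        · simp [h] }
  have hmp : MeasurePreserving T volume volume := by
    refine measurePreserving_of_involutive_affine volume A (Pi.single j 1) (fun t => ?_) hinv
    ext i
    by_cases h : i = j
    · subst h; simp [T, A]; ring
    · simp [T, A, h]
  unfold simplexAvg
  rw [← setIntegral_comp_involutive hmp hinv]
  · refine integral_congr_ae (Filter.Eventually.of_forall fun t => ?_)
    simp only
    congr 1
    rw [simplexAvg_arg_eq, simplexAvg_arg_eq, hsum, ← sum_update_swap z a t (1 - ∑ i, t i) j]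
    simp [T]
  · intro t ht
    refine ⟨fun i => ?_, ?_⟩
    · by_cases h : i = j
      · subst h; simpa [T] using ht.2
      · simpa [T, h] using ht.1 i
    · rw [hsum]; linarith [ht.1 j]

/-- The integral of a directional derivative of `φ` over the simplex with vertices `0`, `a`,
`z j`. -/
noncomputable def simplexDerivAvg (φ : (ι → ℝ) → ℝ) (a : ι → ℝ) (z : ι → ι → ℝ) (v : ι → ℝ) : ℝ :=
  ∫ q in cornerSimplexProd ι, fderiv ℝ φ (q.1 • a + ∑ j, q.2 j • z j) v

omit [DecidableEq ι] in
lemma integrableOn_simplexDerivAvg {φ : (ι → ℝ) → ℝ} (hφ : ContDiff ℝ 1 φ) (a : ι → ℝ)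
    (z : ι → ι → ℝ) (v : ι → ℝ) :
    IntegrableOn (fun q : ℝ × (ι → ℝ) => fderiv ℝ φ (q.1 • a + ∑ j, q.2 j • z j) v)
      (cornerSimplexProd ι) := by
  refine ContinuousOn.integrableOn_compact isCompact_cornerSimplexProd (Continuous.continuousOn ?_)
  have := hφ.continuous_fderiv one_ne_zero
  fun_prop

lemma simplexDerivAvg_swap (φ : (ι → ℝ) → ℝ) (a : ι → ℝ) (z : ι → ι → ℝ) (v : ι → ℝ) (j : ι) :
    simplexDerivAvg φ (z j) (Function.update z j a) v = simplexDerivAvg φ a z v := by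
  set T : ℝ × (ι → ℝ) → ℝ × (ι → ℝ) := fun q => (q.2 j, Function.update q.2 j q.1) with hTdef
  have hinv : Function.Involutive T := by
    rintro ⟨s, t⟩
    simp [T]
  let A : ℝ × (ι → ℝ) →ₗ[ℝ] ℝ × (ι → ℝ) :=
    { toFun := T
      map_add' := by
        intro x y
        refine Prod.ext (by simp [T]) ?_
        ext i
        by_cases h : i = j
        · subst h; simp [T]
        · simp [T, h]
      map_smul' := by
        intro c x
        refine Prod.ext (by simp [T]) ?_
        ext i
        by_cases h : i = j
        · subst h; simp [T]
        · simp [T, h] }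
  have hmp : MeasurePreserving T volume volume :=
    measurePreserving_of_involutive_affine (volume.prod volume) A 0 (fun t => by simp [A]) hinv
  unfold simplexDerivAvg
  rw [← setIntegral_comp_involutive hmp hinv]
  · refine integral_congr_ae (Filter.Eventually.of_forall fun q => ?_)
    simp only [T]
    rw [sum_update_swap z a q.2 q.1 j]
  · rintro ⟨s, t⟩ ⟨h1, h2, h3⟩
    refine ⟨h2 j, fun i => ?_, ?_⟩
    · by_cases h : i = j
      · subst h; simpa [T] using h1
      · simpa [T, h] using h2 i
    · have := sum_update_eq t s j
      simp only [T] at h3 ⊢; linarith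

omit [DecidableEq ι] in
lemma simplexDerivAvg_self {φ : (ι → ℝ) → ℝ} (hφ : ContDiff ℝ 1 φ) (a : ι → ℝ)
    (z : ι → ι → ℝ) :
    simplexDerivAvg φ a z a = simplexAvg φ a z - simplexAvg φ 0 z := by
  have hcd : Continuous (fderiv ℝ φ) := hφ.continuous_fderiv one_ne_zero
  have hc : Continuous φ := hφ.continuous
  have hint := integrableOn_simplexDerivAvg hφ a z a
  rw [← integrable_indicator_iff isClosed_cornerSimplexProd.measurableSet] at hint
  unfold simplexDerivAvg simplexAvg
  rw [← integral_sub]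
  rotate_left
  · refine ContinuousOn.integrableOn_compact isCompact_cornerSimplex (Continuous.continuousOn ?_)
    fun_prop
  · refine ContinuousOn.integrableOn_compact isCompact_cornerSimplex (Continuous.continuousOn ?_)
    fun_prop
  rw [← integral_indicator isClosed_cornerSimplexProd.measurableSet,
    ← integral_indicator isClosed_cornerSimplex.measurableSet]
  rw [Measure.volume_eq_prod] at hint ⊢
  rw [integral_prod_symm _ hint]
  congr 1
  ext t
  by_cases ht : t ∈ cornerSimplex ι
  · rw [Set.indicator_of_mem ht]
    have h0 : (0 : ℝ) ≤ 1 - ∑ i, t i := by linarith [ht.2]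
    have : ∀ s : ℝ, (cornerSimplexProd ι).indicator
        (fun q : ℝ × (ι → ℝ) => fderiv ℝ φ (q.1 • a + ∑ j, q.2 j • z j) a) (s, t)
        = (Set.Icc 0 (1 - ∑ i, t i)).indicator
          (fun s => fderiv ℝ φ (s • a + ∑ j, t j • z j) a) s := by
      intro s
      by_cases hs : s ∈ Set.Icc 0 (1 - ∑ i, t i)
      · rw [Set.indicator_of_mem hs, Set.indicator_of_mem]
        exact ⟨hs.1, ht.1, by have := hs.2; simp only; linarith⟩
      · rw [Set.indicator_of_notMem hs, Set.indicator_of_notMem]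
        rintro ⟨h1, h2, h3⟩
        exact hs ⟨h1, by simp only at h3; linarith⟩
    simp_rw [this]
    rw [integral_indicator measurableSet_Icc, integral_Icc_eq_integral_Ioc,
      ← intervalIntegral.integral_of_le h0]
    rw [intervalIntegral.integral_eq_sub_of_hasDerivAt
      (f := fun s : ℝ => φ (s • a + ∑ j, t j • z j))]
    · rw [simplexAvg_arg_eq]; simp
    · intro s _
      have h1 : HasDerivAt (fun s : ℝ => s • a + ∑ j, t j • z j) a s := by
        simpa using ((hasDerivAt_id s).smul_const a).add_const (∑ j, t j • z j)
      exact ((hφ.differentiable one_ne_zero _).hasFDerivAt).comp_hasDerivAt s h1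
    · refine Continuous.intervalIntegrable ?_ _ _
      fun_prop
  · rw [Set.indicator_of_notMem ht]
    have : ∀ s : ℝ, (cornerSimplexProd ι).indicator
        (fun q : ℝ × (ι → ℝ) => fderiv ℝ φ (q.1 • a + ∑ j, q.2 j • z j) a) (s, t) = 0 := by
      intro s
      rw [Set.indicator_of_notMem]
      rintro ⟨h1, h2, h3⟩
      exact ht ⟨h2, by simp only at h1 h3; linarith⟩
    simp [this]

lemma det_sub_eq (z : ι → ι → ℝ) (a : ι → ℝ) :
    (Matrix.of fun j => z j - a).det =
      (Matrix.of z).det - ∑ j, (Matrix.of (Function.update z j a)).det := by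
  have key : ∀ s : Finset ι, (Matrix.of fun j => if j ∈ s then z j - a else z j).det =
      (Matrix.of z).det - ∑ j ∈ s, (Matrix.of (Function.update z j a)).det := by
    intro s
    induction s using Finset.induction_on with
    | empty => simp
    | insert k s hk ih =>
      set w : ι → ι → ℝ := fun j => if j ∈ s then z j - a else z j with hw
      have h1 : (Matrix.of fun j => if j ∈ insert k s then z j - a else z j)
          = (Matrix.of w).updateRow k (z k - a) := by
        ext i l
        by_cases h : i = k
        · subst h; simp
        · simp [h, w]
      have h2 : (Matrix.of w).updateRow k (z k) = Matrix.of w := by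
        ext i l
        by_cases h : i = k
        · subst h; simp [w, hk]
        · simp [h]
      have h3 : ((Matrix.of w).updateRow k (-a)).det = -(Matrix.of (Function.update z k a)).det := by
        rw [show (-a : ι → ℝ) = (-1 : ℝ) • a by simp, Matrix.det_updateRow_smul]
        rw [neg_one_mul, neg_inj]
        refine Matrix.det_eq_of_forall_row_eq_smul_add_const
          (fun i => if i ∈ s then -1 else 0) k (by simp [hk]) fun i l => ?_
        by_cases h : i = k
        · subst h; simp [hk]
        · by_cases h' : i ∈ s
          · simp [h, h', w]; ring
          · simp [h, h', w]
      rw [h1, sub_eq_add_neg, Matrix.det_updateRow_add, h2, h3, Finset.sum_insert hk, ih]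
      ring
  simpa using key Finset.univ

lemma sum_det_update_smul (z : ι → ι → ℝ) (a : ι → ℝ) :
    ∑ j, (Matrix.of (Function.update z j a)).det • z j = (Matrix.of z).det • a := by
  have := Matrix.mulVec_cramer (Matrix.of z).transpose a
  rw [Matrix.det_transpose] at this
  rw [← this]
  ext i
  simp only [Matrix.mulVec, dotProduct, Matrix.cramer_apply, Finset.sum_apply, Pi.smul_apply,
    smul_eq_mul]
  refine Finset.sum_congr rfl fun j _ => ?_
  rw [mul_comm, Matrix.updateCol_transpose, Matrix.det_transpose]
  rfl

/-- The oriented integral over a simplex is the alternating sum of the oriented integrals over the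
cones from the origin over its facets. -/
lemma simplexIntegral_eq_sub_sum {φ : (ι → ℝ) → ℝ} (hφ : ContDiff ℝ 1 φ) (a : ι → ℝ)
    (z : ι → ι → ℝ) :
    simplexIntegral φ a z =
      simplexIntegral φ 0 z - ∑ j, simplexIntegral φ 0 (Function.update z j a) := by
  have h0 : simplexAvg φ 0 z = simplexAvg φ a z - simplexDerivAvg φ a z a := by
    rw [simplexDerivAvg_self hφ]; ring
  have hj : ∀ j, simplexAvg φ 0 (Function.update z j a) =
      simplexAvg φ a z - simplexDerivAvg φ a z (z j) := by
    intro j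
    have := simplexDerivAvg_self hφ (z j) (Function.update z j a)
    rw [simplexDerivAvg_swap, simplexAvg_swap] at this
    linarith
  have hlin : (Matrix.of z).det * simplexDerivAvg φ a z a =
      ∑ j, (Matrix.of (Function.update z j a)).det * simplexDerivAvg φ a z (z j) := by
    unfold simplexDerivAvg
    simp_rw [← integral_const_mul]
    rw [← integral_finsetSum]
    · refine integral_congr_ae (Filter.Eventually.of_forall fun q => ?_)
      simp only
      rw [← smul_eq_mul, ← map_smul, ← sum_det_update_smul z a, map_sum]
      simp
    · intro j _
      exact (integrableOn_simplexDerivAvg hφ a z (z j)).const_mul _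
  unfold simplexIntegral
  simp only [sub_zero, hj, h0]
  rw [det_sub_eq]
  simp only [mul_sub, Finset.sum_sub_distrib, sub_mul, ← Finset.sum_mul, ← hlin]
  ring

lemma simplexIntegral_zero_perm (φ : (ι → ℝ) → ℝ) (z : ι → ι → ℝ) (ρ : Equiv.Perm ι) :
    simplexIntegral φ 0 (z ∘ ρ) = (Equiv.Perm.sign ρ : ℤ) * simplexIntegral φ 0 z := by
  have hmp := volume_measurePreserving_piCongrLeft (fun _ : ι => ℝ) ρ
  have havg : simplexAvg φ 0 (z ∘ ρ) = simplexAvg φ 0 z := by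
    unfold simplexAvg
    symm
    rw [← hmp.setIntegral_preimage_emb (MeasurableEquiv.measurableEmbedding _)]
    have hval : ∀ t : ι → ℝ, ∀ i, (MeasurableEquiv.piCongrLeft (fun _ : ι => ℝ) ρ) t i =
        t (ρ.symm i) := by
      intro t i
      obtain ⟨i, rfl⟩ := ρ.surjective i
      simp [MeasurableEquiv.coe_piCongrLeft]
    have hset : (MeasurableEquiv.piCongrLeft (fun _ : ι => ℝ) ρ) ⁻¹' cornerSimplex ι =
        cornerSimplex ι := by
      ext t
      simp only [cornerSimplex, Set.mem_preimage, Set.mem_ofPred_eq, hval]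
      rw [Equiv.sum_comp ρ.symm t]
      refine and_congr ⟨fun h i => by simpa using h (ρ i), fun h i => h _⟩ Iff.rfl
    rw [hset]
    refine integral_congr_ae (Filter.Eventually.of_forall fun t => ?_)
    simp only [hval]
    congr 2
    rw [← Equiv.sum_comp ρ]
    simp
  unfold simplexIntegral
  rw [havg, ← mul_assoc, ← Matrix.det_permute]
  rfl

lemma simplexIntegral_eq_zero_of_eq (φ : (ι → ℝ) → ℝ) (a : ι → ℝ) (z : ι → ι → ℝ) {j : ι}
    (h : z j = a) : simplexIntegral φ a z = 0 := by
  unfold simplexIntegral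
  rw [Matrix.det_eq_zero_of_row_eq_zero j, zero_mul]
  intro i; simp [h]

lemma simplexIntegral_eq_zero_of_eq_of_ne (φ : (ι → ℝ) → ℝ) (a : ι → ℝ) (z : ι → ι → ℝ) {j k : ι}
    (hjk : j ≠ k) (h : z j = z k) : simplexIntegral φ a z = 0 := by
  unfold simplexIntegral
  rw [Matrix.det_zero_of_row_eq hjk, zero_mul]
  ext i
  simp [h]

end Simplex

section Bound

variable {ι : Type*} [Fintype ι] [DecidableEq ι]

/-- Hölder's inequality for the oriented integral over a simplex of diameter at most `R`. -/
lemma abs_simplexIntegral_le {φ : (ι → ℝ) → ℝ} (hφ : Continuous φ) {p p' : ℝ} (hp : 1 < p)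
    (hp' : p' = p / (p - 1)) (hfin : eLpNorm φ (ENNReal.ofReal p') volume < ⊤)
    {a : ι → ℝ} {z : ι → ι → ℝ} {R : ℝ} (hz : ∀ j, ‖z j - a‖ ≤ R) :
    |simplexIntegral φ a z| ≤ ((Fintype.card ι).factorial * R ^ Fintype.card ι) ^ (1 / p) *
      (eLpNorm φ (ENNReal.ofReal p') volume).toReal := by
  have hp0 : 0 < p - 1 := by linarith
  have hp'1 : 1 < p' := by rw [hp', lt_div_iff₀ hp0]; linarith
  have hconj : 1 - 1 / p' = 1 / p := by rw [hp']; field_simp; ring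
  have hp'0 : 0 < p' := by linarith
  set D := (Matrix.of fun j => z j - a).det with hD
  have hDle : |D| ≤ (Fintype.card ι).factorial * R ^ Fintype.card ι := by
    have := Matrix.det_le (A := Matrix.of fun j => z j - a) (abv := AbsoluteValue.abs) (x := R)
      (fun i j => ?_)
    · simpa using this
    · simpa using (norm_le_pi_norm (z i - a) j).trans (hz i)
  have hN : 0 ≤ (eLpNorm φ (ENNReal.ofReal p') volume).toReal := ENNReal.toReal_nonneg
  refine le_trans ?_ (mul_le_mul_of_nonneg_right
    (Real.rpow_le_rpow (abs_nonneg D) hDle (by positivity)) hN)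
  by_cases hD0 : D = 0
  · rw [simplexIntegral, ← hD, hD0, zero_mul, abs_zero]
    positivity
  set M := (Matrix.of fun j => z j - a).transpose with hM
  have hMdet : M.det = D := Matrix.det_transpose _
  set g : (ι → ℝ) → ℝ := fun t => φ (a + ∑ j, t j • (z j - a)) with hg
  have hgc : Continuous g := by fun_prop
  have hgM : g = (fun x => φ (a + x)) ∘ Matrix.toLin' M := by
    ext t
    simp only [hg, Function.comp]
    congr 2
    ext i
    simp [M, Matrix.mulVec, dotProduct, mul_comm]
  have hnorm : eLpNorm g (ENNReal.ofReal p') volume =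
      ENNReal.ofReal |D⁻¹| ^ (1 / p') * eLpNorm φ (ENNReal.ofReal p') volume := by
    have hc : Continuous fun x => φ (a + x) := by fun_prop
    rw [hgM, ← eLpNorm_map_measure hc.aestronglyMeasurable
      (LinearMap.continuous_of_finiteDimensional _).aemeasurable,
      Real.map_matrix_volume_pi_eq_smul_volume_pi (by rwa [hMdet]), hMdet,
      eLpNorm_smul_measure_of_ne_zero (by simpa using hD0)]
    rw [smul_eq_mul, show (fun x => φ (a + x)) = φ ∘ (fun x => a + x) from rfl,
      eLpNorm_comp_measurePreserving hφ.aestronglyMeasurable (measurePreserving_add_left volume a)]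
    simp [hp'0.le]
  have hle : ‖∫ t in cornerSimplex ι, g t‖ₑ ≤ eLpNorm g (ENNReal.ofReal p') volume := by
    calc ‖∫ t in cornerSimplex ι, g t‖ₑ ≤ eLpNorm g 1 (volume.restrict (cornerSimplex ι)) := by
          rw [eLpNorm_one_eq_lintegral_enorm]; exact enorm_integral_le_lintegral_enorm _
      _ ≤ eLpNorm g (ENNReal.ofReal p') (volume.restrict (cornerSimplex ι)) *
          (volume.restrict (cornerSimplex ι)) Set.univ ^
            (1 / (1 : ENNReal).toReal - 1 / (ENNReal.ofReal p').toReal) :=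
          eLpNorm_le_eLpNorm_mul_rpow_measure_univ (by simpa using hp'1.le)
            hgc.aestronglyMeasurable
      _ ≤ eLpNorm g (ENNReal.ofReal p') volume * 1 := by
          gcongr
          · exact Measure.restrict_le_self
          · rw [Measure.restrict_apply_univ]
            refine ENNReal.rpow_le_one volume_cornerSimplex_le_one ?_
            rw [ENNReal.toReal_ofReal hp'0.le, ENNReal.toReal_one, div_one, hconj]
            positivity
      _ = _ := mul_one _
  have hreal : |∫ t in cornerSimplex ι, g t| ≤
      |D⁻¹| ^ (1 / p') * (eLpNorm φ (ENNReal.ofReal p') volume).toReal := by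
    rw [hnorm] at hle
    have hne : ENNReal.ofReal |D⁻¹| ^ (1 / p') * eLpNorm φ (ENNReal.ofReal p') volume ≠ ⊤ :=
      ENNReal.mul_ne_top (ENNReal.rpow_ne_top_of_nonneg (by positivity) ENNReal.ofReal_ne_top)
        hfin.ne
    have := ENNReal.toReal_mono hne hle
    rw [ENNReal.toReal_mul, ← ENNReal.toReal_rpow, ENNReal.toReal_ofReal (abs_nonneg _)] at this
    simpa using this
  have hDpos : 0 < |D| := abs_pos.mpr hD0
  rw [simplexIntegral, ← hD, abs_mul]
  calc |D| * |simplexAvg φ a z| ≤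
      |D| * (|D⁻¹| ^ (1 / p') * (eLpNorm φ (ENNReal.ofReal p') volume).toReal) := by
        gcongr; exact hreal
    _ = |D| ^ (1 / p) * (eLpNorm φ (ENNReal.ofReal p') volume).toReal := by
        rw [← mul_assoc, abs_inv, Real.inv_rpow hDpos.le, ← Real.rpow_neg hDpos.le]
        congr 1
        rw [← hconj, sub_eq_add_neg, Real.rpow_add hDpos, Real.rpow_one]

end Bound

section Lattice

variable {n : ℕ}

/-- The vertices, other than `m`, of the simplex of the Kuhn triangulation of the lattice cube
`m + [0, 1]ⁿ` belonging to the permutation `π`. -/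
def cubeVertex (m : Fin n → ℤ) (π : Equiv.Perm (Fin n)) (j : Fin n) : Fin n → ℤ :=
  fun i => m i + if π i ≤ j then 1 else 0

/-- `v` is a vertex of the lattice cube `m + [0, 1]ⁿ`. -/
def IsCubeVertex (m v : Fin n → ℤ) : Prop := ∀ i, v i = m i ∨ v i = m i + 1

lemma isCubeVertex_cubeVertex (m : Fin n → ℤ) (π : Equiv.Perm (Fin n)) (j : Fin n) :
    IsCubeVertex m (cubeVertex m π j) := by
  intro i
  unfold cubeVertex
  split_ifs <;> simp

lemma isCubeVertex_self (m : Fin n → ℤ) : IsCubeVertex m m := fun _ => Or.inl rfl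

/-- The oriented integral of `φ` over the image of the lattice cube `m + [0, 1]ⁿ` under the map
that interpolates `g` affinely on each simplex of the Kuhn triangulation. -/
noncomputable def cubeIntegral (φ : (Fin n → ℝ) → ℝ) (g : (Fin n → ℤ) → Fin n → ℝ)
    (m : Fin n → ℤ) : ℝ :=
  ∑ π : Equiv.Perm (Fin n), ((Equiv.Perm.sign π : ℤ) : ℝ) *
    simplexIntegral φ (g m) fun j => g (cubeVertex m π j)

lemma abs_sign_cast (π : Equiv.Perm (Fin n)) : |((Equiv.Perm.sign π : ℤ) : ℝ)| = 1 := by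
  rcases Int.units_eq_one_or (Equiv.Perm.sign π) with h | h <;> simp [h]

lemma abs_cubeIntegral_le {φ : (Fin n → ℝ) → ℝ} (hφ : Continuous φ) {p p' : ℝ} (hp : 1 < p)
    (hp' : p' = p / (p - 1)) (hfin : eLpNorm φ (ENNReal.ofReal p') volume < ⊤)
    {g : (Fin n → ℤ) → Fin n → ℝ} {m : Fin n → ℤ} {R : ℝ}
    (hg : ∀ v, IsCubeVertex m v → ‖g v - g m‖ ≤ R) :
    |cubeIntegral φ g m| ≤ n.factorial * ((n.factorial * R ^ n) ^ (1 / p) *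
      (eLpNorm φ (ENNReal.ofReal p') volume).toReal) := by
  unfold cubeIntegral
  refine (Finset.abs_sum_le_sum_abs _ _).trans ?_
  refine (Finset.sum_le_card_nsmul _ _ _ fun π _ => ?_).trans_eq
    (by rw [Finset.card_univ, Fintype.card_perm, Fintype.card_fin, nsmul_eq_mul])
  rw [abs_mul, abs_sign_cast, one_mul]
  have := abs_simplexIntegral_le hφ hp hp' hfin (a := g m)
    (z := fun j => g (cubeVertex m π j)) (R := R)
    (fun j => hg _ (isCubeVertex_cubeVertex m π j))
  simpa using this

lemma cubeVertex_swap {N : ℕ} (m : Fin (N + 1) → ℤ) (π : Equiv.Perm (Fin (N + 1))) (k : Fin N)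
    {l : Fin (N + 1)} (hl : l ≠ k.castSucc) :
    cubeVertex m (Equiv.swap k.castSucc k.succ * π) l = cubeVertex m π l := by
  ext i
  unfold cubeVertex
  congr 1
  have hiff : (Equiv.swap k.castSucc k.succ * π) i ≤ l ↔ π i ≤ l := by
    rw [Equiv.Perm.mul_apply, Equiv.swap_apply_def]
    have hl' : (l : ℕ) ≠ k := fun h => hl (Fin.ext (by simpa using h))
    split_ifs with h1 h2
    · rw [h1, Fin.le_def, Fin.le_def]; simp; omega
    · rw [h2, Fin.le_def, Fin.le_def]; simp; omega
    · rfl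
  simp only [hiff]

lemma cubeVertex_rotate {N : ℕ} (m : Fin (N + 1) → ℤ) (π : Equiv.Perm (Fin (N + 1)))
    (j : Fin (N + 1)) :
    cubeVertex (m - Pi.single (π.symm (Fin.last N)) 1) (finRotate (N + 1) * π)
      (finRotate (N + 1) j) = if j = Fin.last N then m else cubeVertex m π j := by
  have hval : ∀ x : Fin (N + 1), ((finRotate (N + 1) x : Fin (N + 1)) : ℕ) =
      if x = Fin.last N then 0 else (x : ℕ) + 1 := fun x => by
    rw [coe_finRotate]
  ext i
  have hi : i = π.symm (Fin.last N) ↔ π i = Fin.last N := by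
    rw [Equiv.eq_symm_apply]
  unfold cubeVertex
  simp only [Fin.le_def, Equiv.Perm.mul_apply, hval, Pi.sub_apply]
  by_cases h : π i = Fin.last N
  · have h' := hi.mpr h
    subst h'
    by_cases hj : j = Fin.last N
    · simp [hj]
    · have : ¬ (N ≤ (j : ℕ)) := by
        intro h2
        exact hj (Fin.ext (by simp; omega))
      simp [hj, this]
  · have h' : i ≠ π.symm (Fin.last N) := fun h2 => h (hi.mp h2)
    by_cases hj : j = Fin.last N
    · simp [hj, h, h']
    · simp [hj, h, h']

lemma cubeIntegral_eq_sum_sub {N : ℕ} {φ : (Fin (N + 1) → ℝ) → ℝ} (hφ : ContDiff ℝ 1 φ)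
    (g : (Fin (N + 1) → ℤ) → Fin (N + 1) → ℝ) (m : Fin (N + 1) → ℤ) :
    cubeIntegral φ g m = ∑ π : Equiv.Perm (Fin (N + 1)), ((Equiv.Perm.sign π : ℤ) : ℝ) *
      (simplexIntegral φ 0 (g ∘ cubeVertex m π) -
        simplexIntegral φ 0 (g ∘ cubeVertex (m - Pi.single (π.symm 0) 1) π)) := by
  unfold cubeIntegral
  simp only [simplexIntegral_eq_sub_sum hφ (g m), Fin.sum_univ_castSucc, mul_sub, mul_add,
    Finset.sum_sub_distrib, Finset.sum_add_distrib]
  congr 1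
  have hinner : ∑ π : Equiv.Perm (Fin (N + 1)), ((Equiv.Perm.sign π : ℤ) : ℝ) *
      ∑ k : Fin N, simplexIntegral φ 0
        (Function.update (fun j => g (cubeVertex m π j)) k.castSucc (g m)) = 0 := by
    simp only [Finset.mul_sum]
    rw [Finset.sum_comm]
    refine Finset.sum_eq_zero fun k _ => ?_
    set f : Equiv.Perm (Fin (N + 1)) → ℝ := fun π => ((Equiv.Perm.sign π : ℤ) : ℝ) *
      simplexIntegral φ 0 (Function.update (fun j => g (cubeVertex m π j)) k.castSucc (g m))
      with hf
    have hneg : ∀ π, f (Equiv.swap k.castSucc k.succ * π) = -f π := by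
      intro π
      have hz : Function.update
          (fun j => g (cubeVertex m (Equiv.swap k.castSucc k.succ * π) j)) k.castSucc (g m) =
          Function.update (fun j => g (cubeVertex m π j)) k.castSucc (g m) := by
        ext1 l
        by_cases hl : l = k.castSucc
        · simp [hl]
        · simp only [Function.update_of_ne hl, cubeVertex_swap m π k hl]
      simp only [hf]
      rw [hz, Equiv.Perm.sign_mul, Equiv.Perm.sign_swap (Fin.castSucc_lt_succ).ne]
      simp
    have h1 : ∑ π, f π = ∑ π, f (Equiv.swap k.castSucc k.succ * π) :=
      (Equiv.sum_comp (Equiv.mulLeft (Equiv.swap k.castSucc k.succ)) f).symm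
    have h2 : ∑ π, f (Equiv.swap k.castSucc k.succ * π) = -∑ π, f π := by
      rw [← Finset.sum_neg_distrib]
      exact Finset.sum_congr rfl fun π _ => hneg π
    change ∑ π, f π = 0
    linarith
  rw [hinner, zero_add]
  symm
  rw [← Equiv.sum_comp (Equiv.mulLeft (finRotate (N + 1)))]
  refine Finset.sum_congr rfl fun π _ => ?_
  have hsymm : (finRotate (N + 1) * π).symm 0 = π.symm (Fin.last N) := by
    rw [Equiv.symm_apply_eq, Equiv.Perm.mul_apply, Equiv.apply_symm_apply, finRotate_last]
  simp only [Equiv.coe_mulLeft, hsymm, Equiv.Perm.sign_mul]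
  have hz : Function.update (fun j => g (cubeVertex m π j)) (Fin.last N) (g m) =
      (g ∘ cubeVertex (m - Pi.single (π.symm (Fin.last N)) 1) (finRotate (N + 1) * π)) ∘
        finRotate (N + 1) := by
    ext1 j
    simp only [Function.comp, cubeVertex_rotate]
    by_cases hj : j = Fin.last N
    · subst hj; simp
    · simp [hj]
  rw [hz, simplexIntegral_zero_perm]
  push_cast
  ring

lemma sum_cubeIntegral_congr {N : ℕ} {φ : (Fin (N + 1) → ℝ) → ℝ} (hφ : ContDiff ℝ 1 φ)
    (A : Finset (Fin (N + 1) → ℤ)) {g g' : (Fin (N + 1) → ℤ) → Fin (N + 1) → ℝ}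
    (h : ∀ v, (∃ m ∉ A, IsCubeVertex m v) → g v = g' v) :
    ∑ m ∈ A, cubeIntegral φ g m = ∑ m ∈ A, cubeIntegral φ g' m := by
  rw [← sub_eq_zero, ← Finset.sum_sub_distrib]
  simp only [cubeIntegral_eq_sum_sub hφ, ← Finset.sum_sub_distrib, ← mul_sub]
  rw [Finset.sum_comm]
  refine Finset.sum_eq_zero fun π _ => ?_
  rw [← Finset.mul_sum]
  refine mul_eq_zero_of_right _ ?_
  set e : Fin (N + 1) → ℤ := Pi.single (π.symm 0) 1 with he
  set Q : (Fin (N + 1) → ℤ) → ℝ := fun m => simplexIntegral φ 0 (g ∘ cubeVertex m π) -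
    simplexIntegral φ 0 (g' ∘ cubeVertex m π) with hQ
  have hvert : ∀ m j, IsCubeVertex (m + e) (cubeVertex m π j) := by
    intro m j i
    by_cases hi : i = π.symm 0
    · subst hi
      left; simp [cubeVertex, e]
    · have := isCubeVertex_cubeVertex m π j i
      simpa [e, hi] using this
  have hQ0 : ∀ m, (m ∉ A ∨ m + e ∉ A) → Q m = 0 := by
    intro m hm
    have : g ∘ cubeVertex m π = g' ∘ cubeVertex m π := by
      ext1 j
      apply h
      rcases hm with hm | hm
      · exact ⟨m, hm, isCubeVertex_cubeVertex m π j⟩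
      · exact ⟨m + e, hm, hvert m j⟩
    simp [hQ, this]
  have hsum : ∑ m ∈ A, Q m = ∑ m ∈ A, Q (m - e) := by
    refine Finset.sum_bij_ne_zero (fun m _ _ => m + e) ?_ ?_ ?_ ?_
    · intro m _ hne
      by_contra hmem
      exact hne (hQ0 m (Or.inr hmem))
    · intro m _ _ m' _ _ heq
      exact add_right_cancel heq
    · intro m hm hne
      refine ⟨m - e, ?_, hne, by simp⟩
      by_contra hmem
      exact hne (hQ0 _ (Or.inl hmem))
    · intro m _ _
      simp
  have hgoal : ∀ m, (simplexIntegral φ 0 (g ∘ cubeVertex m π) -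
      simplexIntegral φ 0 (g ∘ cubeVertex (m - e) π) -
      (simplexIntegral φ 0 (g' ∘ cubeVertex m π) -
        simplexIntegral φ 0 (g' ∘ cubeVertex (m - e) π))) = Q m - Q (m - e) := by
    intro m; simp only [hQ]; ring
  simp only [hgoal, Finset.sum_sub_distrib, hsum, sub_self]

/-- The lattice point below `m / 2`. -/
def halfPoint (m : Fin n → ℤ) : Fin n → ℤ := fun i => m i / 2

lemma cubeIntegral_comp_halfPoint_of_even {N : ℕ} (φ : (Fin (N + 1) → ℝ) → ℝ)
    (g : (Fin (N + 1) → ℤ) → Fin (N + 1) → ℝ) {m : Fin (N + 1) → ℤ} {i : Fin (N + 1)}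
    (hi : m i % 2 = 0) : cubeIntegral φ (g ∘ halfPoint) m = 0 := by
  unfold cubeIntegral
  refine Finset.sum_eq_zero fun π _ => mul_eq_zero_of_right _ ?_
  have hinj : ∀ k, π k = π i ↔ k = i := fun k => π.injective.eq_iff
  rcases Fin.eq_zero_or_eq_succ (π i) with h0 | ⟨k, hk⟩
  · refine simplexIntegral_eq_zero_of_eq φ _ _ (j := 0) ?_
    simp only [Function.comp]
    congr 1
    ext l
    simp only [halfPoint, cubeVertex]
    by_cases hl : l = i
    · subst hl
      simp [h0]; omega
    · have : ¬ π l ≤ 0 := by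
        intro h
        exact hl ((hinj l).mp (by rw [h0]; exact Fin.le_zero_iff.mp h))
      simp [this]
  · refine simplexIntegral_eq_zero_of_eq_of_ne φ _ _ (j := k.castSucc) (k := k.succ)
      (Fin.castSucc_lt_succ).ne ?_
    simp only [Function.comp]
    congr 1
    ext l
    simp only [halfPoint, cubeVertex]
    by_cases hl : l = i
    · subst hl
      have h1 : ¬ (k.succ ≤ k.castSucc) := not_le.mpr Fin.castSucc_lt_succ
      simp [hk, h1]; omega
    · have : (π l ≤ k.castSucc) ↔ (π l ≤ k.succ) := by
        have hne : π l ≠ k.succ := fun h => hl ((hinj l).mp (by rw [hk, h]))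
        have : ((π l : Fin (N + 1)) : ℕ) ≠ k + 1 := fun h => hne (Fin.ext (by simpa using h))
        rw [Fin.le_def, Fin.le_def]
        simp; omega
      simp [this]

lemma cubeIntegral_comp_halfPoint_of_odd (φ : (Fin n → ℝ) → ℝ)
    (g : (Fin n → ℤ) → Fin n → ℝ) (m : Fin n → ℤ) :
    cubeIntegral φ (g ∘ halfPoint) (fun i => 2 * m i + 1) = cubeIntegral φ g m := by
  unfold cubeIntegral
  refine Finset.sum_congr rfl fun π _ => ?_
  have h1 : halfPoint (fun i => 2 * m i + 1) = m := by
    ext i; simp only [halfPoint]; omega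
  have h2 : ∀ j, halfPoint (cubeVertex (fun i => 2 * m i + 1) π j) = cubeVertex m π j := by
    intro j; ext i; simp only [halfPoint, cubeVertex]; split_ifs <;> omega
  simp only [Function.comp, h1, h2]

lemma sum_cubeIntegral_comp_halfPoint {N : ℕ} (φ : (Fin (N + 1) → ℝ) → ℝ)
    (g : (Fin (N + 1) → ℤ) → Fin (N + 1) → ℝ) {A B : Finset (Fin (N + 1) → ℤ)}
    (hB : ∀ m, m ∈ B ↔ halfPoint m ∈ A) :
    ∑ m ∈ B, cubeIntegral φ (g ∘ halfPoint) m = ∑ m ∈ A, cubeIntegral φ g m := by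
  symm
  refine Finset.sum_of_injOn (fun m i => 2 * m i + 1) ?_ ?_ ?_ ?_
  · intro m _ m' _ h
    ext i
    have := congrFun h i
    simp only at this; omega
  · intro m hm
    have : halfPoint (fun i => 2 * m i + 1) = m := by
      ext i; simp only [halfPoint]; omega
    simpa [hB, this] using hm
  · intro m hm hne
    by_cases h : ∃ i, m i % 2 = 0
    · obtain ⟨i, hi⟩ := h
      exact cubeIntegral_comp_halfPoint_of_even φ g hi
    · push Not at h
      refine absurd ⟨halfPoint m, (hB m).mp hm, ?_⟩ hne
      ext i
      have := h i
      simp only [halfPoint]; omega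
  · intro m _
    exact (cubeIntegral_comp_halfPoint_of_odd φ g m).symm

end Lattice

section Scales

variable {n : ℕ}

/-- The point of the lattice of mesh `h` with index `m`. -/
def latticePoint (h : ℝ) (m : Fin n → ℤ) : Fin n → ℝ := fun i => h * m i

/-- The closed cube of side `h` with lower corner `latticePoint h m`. -/
def latticeCube (h : ℝ) (m : Fin n → ℤ) : Set (Fin n → ℝ) :=
  {x | ∀ i, h * m i ≤ x i ∧ x i ≤ h * m i + h}

lemma latticePoint_mem_latticeCube {h : ℝ} (hh : 0 ≤ h) {m v : Fin n → ℤ}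
    (hv : IsCubeVertex m v) : latticePoint h v ∈ latticeCube h m := by
  intro i
  unfold latticePoint
  rcases hv i with h1 | h1 <;> rw [h1]
  · constructor <;> linarith
  · push_cast; constructor <;> linarith

lemma latticeCube_subset_halfPoint {h : ℝ} (hh : 0 ≤ h) (m : Fin n → ℤ) :
    latticeCube h m ⊆ latticeCube (2 * h) (halfPoint m) := by
  intro x hx i
  obtain ⟨h1, h2⟩ := hx i
  have e1 : (2 * (halfPoint m i) : ℤ) ≤ m i := by unfold halfPoint; omega
  have e2 : m i ≤ 2 * (halfPoint m i) + 1 := by unfold halfPoint; omega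
  have e1' : 2 * (halfPoint m i : ℝ) ≤ m i := by exact_mod_cast e1
  have e2' : (m i : ℝ) ≤ 2 * (halfPoint m i : ℝ) + 1 := by exact_mod_cast e2
  constructor <;> nlinarith

lemma isCubeVertex_halfPoint {m v : Fin n → ℤ} (hv : IsCubeVertex m v) :
    IsCubeVertex (halfPoint m) (halfPoint v) := by
  intro i
  have := hv i
  unfold halfPoint
  omega

lemma norm_sub_le_of_mem_latticeCube {h : ℝ} (hh : 0 ≤ h) {m : Fin n → ℤ} {x y : Fin n → ℝ}
    (hx : x ∈ latticeCube h m) (hy : y ∈ latticeCube h m) : ‖x - y‖ ≤ h := by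
  rw [pi_norm_le_iff_of_nonneg hh]
  intro i
  rw [Pi.sub_apply, Real.norm_eq_abs, abs_le]
  have := hx i
  have := hy i
  constructor <;> linarith

lemma exists_mem_frontier_norm_sub_le {E : Type*} [NormedAddCommGroup E] [NormedSpace ℝ E]
    {U : Set E} {x y : E} (hx : x ∈ U) (hy : y ∉ U) : ∃ z ∈ frontier U, ‖x - z‖ ≤ ‖x - y‖ := by
  have hne : (segment ℝ x y ∩ frontier U).Nonempty := by
    by_contra hempty
    have hout : ∀ z ∈ segment ℝ x y, z ∉ frontier U := fun z hz hz' => hempty ⟨z, hz, hz'⟩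
    have hcov : ∀ z ∈ segment ℝ x y, z ∈ closure U → z ∈ interior U := fun z hz hzU => by
      by_contra h
      exact hout z hz ⟨hzU, h⟩
    obtain ⟨z, -, hz1, hz2⟩ := (convex_segment x y).isPreconnected (interior U) (closure U)ᶜ
      isOpen_interior isClosed_closure.isOpen_compl
      (fun z hz => by
        by_cases h : z ∈ closure U
        · exact Or.inl (hcov z hz h)
        · exact Or.inr h)
      ⟨x, left_mem_segment ℝ x y, hcov x (left_mem_segment ℝ x y) (subset_closure hx)⟩
      ⟨y, right_mem_segment ℝ x y, fun h =>
        hy (interior_subset (hcov y (right_mem_segment ℝ x y) h))⟩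
    exact hz2 (subset_closure (interior_subset hz1))
  obtain ⟨z, hz, hzU⟩ := hne
  refine ⟨z, hzU, ?_⟩
  obtain ⟨a, b, ha, hb, hab, rfl⟩ := hz
  have : x - (a • x + b • y) = b • (x - y) := by
    have : a = 1 - b := by linarith
    subst this
    rw [sub_smul, one_smul, smul_sub]; abel
  rw [this, norm_smul, Real.norm_of_nonneg hb]
  exact mul_le_of_le_one_left (norm_nonneg _) (by linarith)

lemma finite_latticePoint_mem {U : Set (Fin n → ℝ)} (hU : Bornology.IsBounded U) {h : ℝ}
    (hh : 0 < h) : {m : Fin n → ℤ | latticePoint h m ∈ U}.Finite := by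
  obtain ⟨R, hR⟩ := hU.exists_norm_le
  refine (Set.finite_Icc (fun _ => -⌈R / h⌉ : Fin n → ℤ) (fun _ => ⌈R / h⌉)).subset fun m hm => ?_
  have key : ∀ i, |(m i : ℝ)| ≤ ⌈R / h⌉ := fun i => by
    refine le_trans ?_ (Int.le_ceil _)
    rw [le_div_iff₀ hh]
    have := (norm_le_pi_norm (latticePoint h m) i).trans (hR _ hm)
    rw [latticePoint, Real.norm_eq_abs, abs_mul, abs_of_pos hh] at this
    linarith
  constructor <;> intro i
  · have := (abs_le.mp (key i)).1
    exact_mod_cast this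
  · have := (abs_le.mp (key i)).2
    exact_mod_cast this

lemma card_le_of_near {F : Set (Fin n → ℝ)} {K r h : ℝ} (hr : 0 < h) (R : ℕ)
    {S : Finset (Fin n → ℝ)} (hScard : (S.card : ℝ) ≤ K * h ^ r)
    (hS : F ⊆ ⋃ c ∈ S, Metric.closedBall c h) {T : Finset (Fin n → ℤ)}
    (hT : ∀ m ∈ T, ∃ y ∈ F, ‖latticePoint h m - y‖ ≤ R * h) :
    (T.card : ℝ) ≤ (2 * (R + 1) + 1) ^ n * (K * h ^ r) := by
  classical
  set I : (Fin n → ℝ) → Finset (Fin n → ℤ) := fun c =>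
    Fintype.piFinset fun i => Finset.Icc ⌈c i / h - (R + 1)⌉ ⌊c i / h + (R + 1)⌋ with hI
  have hIcard : ∀ c, ((I c).card : ℝ) ≤ (2 * (R + 1) + 1) ^ n := by
    intro c
    rw [hI, Fintype.card_piFinset]
    push_cast
    refine (Finset.prod_le_prod (g := fun _ => (2 * (R + 1) + 1 : ℝ)) (fun i _ => by positivity)
      fun i _ => ?_).trans_eq (by simp)
    rw [Int.card_Icc]
    have h1 := Int.floor_le (c i / h + (R + 1))
    have h2 := Int.le_ceil (c i / h - (R + 1))
    rw [← Int.cast_natCast (R := ℝ), Int.toNat_eq_max]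
    push_cast
    refine max_le ?_ (by positivity)
    linarith
  have hsub : T ⊆ S.biUnion I := by
    intro m hm
    obtain ⟨y, hy, hmy⟩ := hT m hm
    obtain ⟨c, hc, hyc⟩ := Set.mem_iUnion₂.mp (hS hy)
    rw [Finset.mem_biUnion]
    refine ⟨c, hc, ?_⟩
    rw [hI, Fintype.mem_piFinset]
    intro i
    rw [mem_closedBall_iff_norm] at hyc
    have h1 : ‖latticePoint h m - c‖ ≤ (R + 1) * h := by
      have := norm_sub_le_norm_sub_add_norm_sub (latticePoint h m) y c
      linarith
    have h2 := (norm_le_pi_norm _ i).trans h1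
    rw [Pi.sub_apply, Real.norm_eq_abs, abs_le, latticePoint] at h2
    rw [Finset.mem_Icc, Int.ceil_le, Int.le_floor]
    have h3 : c i = c i / h * h := by field_simp
    rw [h3] at h2
    constructor <;> nlinarith
  calc (T.card : ℝ) ≤ (S.biUnion I).card := by exact_mod_cast Finset.card_le_card hsub
    _ ≤ ∑ c ∈ S, ((I c).card : ℝ) := by exact_mod_cast Finset.card_biUnion_le
    _ ≤ ∑ c ∈ S, (2 * (R + 1) + 1 : ℝ) ^ n := Finset.sum_le_sum fun c _ => hIcard c
    _ = S.card * (2 * (R + 1) + 1 : ℝ) ^ n := by simp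
    _ ≤ _ := by
      rw [mul_comm]
      gcongr

/-- The sum of the oriented integrals over the cubes of mesh `h` contained in `U` changes little
when the mesh is halved. -/
lemma abs_sum_cubeIntegral_sub_le {N : ℕ} {U : Set (Fin (N + 1) → ℝ)} {φ : (Fin (N + 1) → ℝ) → ℝ}
    (hφ : ContDiff ℝ 1 φ) {p p' α h M K r : ℝ} (hα : 0 < α) (hp : 1 < p) (hp' : p' = p / (p - 1))
    (hfin : eLpNorm φ (ENNReal.ofReal p') volume < ⊤) (hh : 0 < h) (hM : 0 ≤ M)
    {f : (Fin (N + 1) → ℝ) → Fin (N + 1) → ℝ}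
    (hf : ∀ x ∈ U, ∀ y ∈ U, ‖f x - f y‖ ≤ M * ‖x - y‖ ^ α)
    {S : Finset (Fin (N + 1) → ℝ)} (hScard : (S.card : ℝ) ≤ K * h ^ r)
    (hS : frontier U ⊆ ⋃ c ∈ S, Metric.closedBall c h)
    {A A' : Finset (Fin (N + 1) → ℤ)} (hA : ∀ m, m ∈ A ↔ latticeCube (2 * h) m ⊆ U)
    (hA' : ∀ m, m ∈ A' ↔ latticeCube h m ⊆ U) :
    |∑ m ∈ A', cubeIntegral φ (f ∘ latticePoint h) m -
      ∑ m ∈ A, cubeIntegral φ (f ∘ latticePoint (2 * h)) m| ≤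
      2 * (9 ^ (N + 1) * (K * h ^ r)) * ((N + 1).factorial *
        (((N + 1).factorial * (M * (2 * h) ^ α) ^ (N + 1)) ^ (1 / p) *
          (eLpNorm φ (ENNReal.ofReal p') volume).toReal)) := by
  classical
  set c : ℝ := (N + 1).factorial *
        (((N + 1).factorial * (M * (2 * h) ^ α) ^ (N + 1)) ^ (1 / p) *
          (eLpNorm φ (ENNReal.ofReal p') volume).toReal) with hc
  have hc0 : 0 ≤ c := by positivity
  set g := f ∘ latticePoint h with hg
  set gc := f ∘ latticePoint (2 * h) with hgc
  set B := A'.filter fun m => halfPoint m ∈ A with hBdef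
  have hB : ∀ m, m ∈ B ↔ halfPoint m ∈ A := by
    intro m
    rw [hBdef, Finset.mem_filter, and_iff_right_iff_imp]
    intro hm
    exact (hA' m).mpr ((latticeCube_subset_halfPoint hh.le m).trans ((hA _).mp hm))
  set bad : (Fin (N + 1) → ℤ) → Prop := fun v => ∃ m ∉ B, IsCubeVertex m v with hbad
  set g₀ : (Fin (N + 1) → ℤ) → Fin (N + 1) → ℝ := fun v => if bad v then g v else gc (halfPoint v)
    with hg₀
  set near : (Fin (N + 1) → ℤ) → Prop := fun m =>
    ∃ z ∈ frontier U, ‖latticePoint h m - z‖ ≤ (3 : ℕ) * h with hnear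
  set T := A'.filter near with hT
  have hTcard : (T.card : ℝ) ≤ 9 ^ (N + 1) * (K * h ^ r) := by
    have := card_le_of_near hh 3 hScard hS (T := T) (fun m hm => (Finset.mem_filter.mp hm).2)
    norm_num at this ⊢
    exact this
  -- a lattice point of `U` near a cube that does not have its double inside `U`
  have hnear' : ∀ m ∈ A', ∀ m' ∉ B, (∃ v, IsCubeVertex m v ∧ IsCubeVertex m' v) → near m := by
    rintro m hm m' hm' ⟨v, hv, hv'⟩
    have hmem : ¬ latticeCube (2 * h) (halfPoint m') ⊆ U := by rwa [← hA, ← hB]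
    obtain ⟨y, hy, hyU⟩ := Set.not_subset.mp hmem
    have hmU : latticePoint h m ∈ U :=
      (hA' m).mp hm (latticePoint_mem_latticeCube hh.le (isCubeVertex_self m))
    obtain ⟨z, hz, hle⟩ := exists_mem_frontier_norm_sub_le hmU hyU
    refine ⟨z, hz, hle.trans ?_⟩
    have h1 := norm_sub_le_of_mem_latticeCube hh.le
      (latticePoint_mem_latticeCube hh.le (isCubeVertex_self m))
      (latticePoint_mem_latticeCube hh.le hv)
    have h2 := norm_sub_le_of_mem_latticeCube (by positivity)
      (latticeCube_subset_halfPoint hh.le m' (latticePoint_mem_latticeCube hh.le hv')) hy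
    have h3 := norm_sub_le_norm_sub_add_norm_sub (latticePoint h m) (latticePoint h v) y
    push_cast
    linarith
  have hbound : ∀ {l : ℝ} {m : Fin (N + 1) → ℤ} {G : (Fin (N + 1) → ℤ) → Fin (N + 1) → ℝ}
      (q : (Fin (N + 1) → ℤ) → Fin (N + 1) → ℝ), 0 ≤ l → l ≤ 2 * h → ∀ m', latticeCube l m' ⊆ U →
      (∀ v, IsCubeVertex m v → q v ∈ latticeCube l m' ∧ G v = f (q v)) →
      |cubeIntegral φ G m| ≤ c := by
    intro l m G q hl0 hl m' hm' hq
    refine abs_cubeIntegral_le hφ.continuous hp hp' hfin fun v hv => ?_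
    obtain ⟨h1, h2⟩ := hq v hv
    obtain ⟨h3, h4⟩ := hq m (isCubeVertex_self m)
    rw [h2, h4]
    refine (hf _ (hm' h1) _ (hm' h3)).trans ?_
    have := (norm_sub_le_of_mem_latticeCube hl0 h1 h3).trans hl
    gcongr
  have hcube_g : ∀ m ∈ A', |cubeIntegral φ g m| ≤ c := fun m hm =>
    hbound (latticePoint h) hh.le (by linarith) m ((hA' m).mp hm) fun v hv =>
      ⟨latticePoint_mem_latticeCube hh.le hv, rfl⟩
  have hcube_gc : ∀ m ∈ B, |cubeIntegral φ (gc ∘ halfPoint) m| ≤ c := fun m hm =>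
    hbound (latticePoint (2 * h) ∘ halfPoint) (by positivity) le_rfl (halfPoint m)
      ((hA _).mp ((hB m).mp hm)) fun v hv =>
      ⟨latticePoint_mem_latticeCube (by positivity) (isCubeVertex_halfPoint hv), rfl⟩
  have hcube_g₀ : ∀ m ∈ B, |cubeIntegral φ g₀ m| ≤ c := fun m hm =>
    hbound (fun v => if bad v then latticePoint h v else latticePoint (2 * h) (halfPoint v))
      (by positivity) le_rfl (halfPoint m) ((hA _).mp ((hB m).mp hm)) fun v hv => by
        by_cases hv' : bad v
        · simp only [hg₀, hv', if_true]
          exact ⟨latticeCube_subset_halfPoint hh.le m (latticePoint_mem_latticeCube hh.le hv), rfl⟩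
        · simp only [hg₀, hv', if_false]
          exact ⟨latticePoint_mem_latticeCube (by positivity) (isCubeVertex_halfPoint hv), rfl⟩
  have hBA' : B ⊆ A' := Finset.filter_subset _ _
  have e1 : ∑ m ∈ A', cubeIntegral φ g m =
      ∑ m ∈ A' \ B, cubeIntegral φ g m + ∑ m ∈ B, cubeIntegral φ g₀ m := by
    rw [← Finset.sum_sdiff hBA', sum_cubeIntegral_congr hφ B (g := g) (g' := g₀)]
    intro v hv
    simp only [hg₀]
    rw [if_pos hv]
  have e2 : ∑ m ∈ A, cubeIntegral φ gc m = ∑ m ∈ B, cubeIntegral φ (gc ∘ halfPoint) m :=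
    (sum_cubeIntegral_comp_halfPoint φ gc hB).symm
  have e3 : ∀ m ∈ B, ¬ near m → cubeIntegral φ g₀ m = cubeIntegral φ (gc ∘ halfPoint) m := by
    intro m hm hnm
    have hgood : ∀ v, IsCubeVertex m v → g₀ v = gc (halfPoint v) := by
      intro v hv
      have : ¬ bad v := by
        rintro ⟨m', hm', hv'⟩
        exact hnm (hnear' m (hBA' hm) m' hm' ⟨v, hv, hv'⟩)
      simp [hg₀, this]
    unfold cubeIntegral
    simp only [Function.comp, hgood _ (isCubeVertex_self m),
      hgood _ (isCubeVertex_cubeVertex m _ _)]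
  rw [e1, e2, add_sub_assoc, ← Finset.sum_sub_distrib]
  have b1 : |∑ m ∈ A' \ B, cubeIntegral φ g m| ≤ (A' \ B).card * c := by
    refine (Finset.abs_sum_le_sum_abs _ _).trans ?_
    rw [← nsmul_eq_mul]
    exact Finset.sum_le_card_nsmul _ _ _ fun m hm => hcube_g m (Finset.mem_sdiff.mp hm).1
  have b2 : |∑ m ∈ B, (cubeIntegral φ g₀ m - cubeIntegral φ (gc ∘ halfPoint) m)| ≤
      (B.filter near).card * (2 * c) := by
    rw [← Finset.sum_filter_add_sum_filter_not B near]
    rw [Finset.sum_eq_zero (s := B.filter fun m => ¬ near m), add_zero]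
    · refine (Finset.abs_sum_le_sum_abs _ _).trans ?_
      rw [← nsmul_eq_mul]
      refine Finset.sum_le_card_nsmul _ _ _ fun m hm => ?_
      have hm' := (Finset.mem_filter.mp hm).1
      refine (abs_sub _ _).trans ?_
      linarith [hcube_g₀ m hm', hcube_gc m hm']
    · intro m hm
      obtain ⟨h1, h2⟩ := Finset.mem_filter.mp hm
      rw [e3 m h1 h2, sub_self]
  have hcards : (A' \ B).card + (B.filter near).card ≤ T.card := by
    rw [← Finset.card_union_of_disjoint]
    · refine Finset.card_le_card (Finset.union_subset ?_ ?_)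
      · intro m hm
        obtain ⟨h1, h2⟩ := Finset.mem_sdiff.mp hm
        exact Finset.mem_filter.mpr
          ⟨h1, hnear' m h1 m h2 ⟨m, isCubeVertex_self m, isCubeVertex_self m⟩⟩
      · exact Finset.filter_subset_filter _ hBA'
    · exact Finset.disjoint_of_subset_right (Finset.filter_subset _ _) Finset.sdiff_disjoint
  have hcards' : ((A' \ B).card : ℝ) + (B.filter near).card ≤ T.card := by exact_mod_cast hcards
  calc _ ≤ ((A' \ B).card : ℝ) * c + (B.filter near).card * (2 * c) :=
        (abs_add_le _ _).trans (add_le_add b1 b2)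
    _ ≤ (((A' \ B).card : ℝ) + (B.filter near).card) * (2 * c) := by
        rw [add_mul]; gcongr; linarith
    _ ≤ (9 ^ (N + 1) * (K * h ^ r)) * (2 * c) := by gcongr; exact hcards'.trans hTcard
    _ = _ := by ring

end Scales

section Limit

variable {n : ℕ}

lemma det_of_apply_permChain (A : (Fin n → ℝ) →L[ℝ] (Fin n → ℝ)) (π : Equiv.Perm (Fin n)) :
    (Matrix.of fun j => A fun i => if π i ≤ j then 1 else 0).det =
      ((Equiv.Perm.sign π : ℤ) : ℝ) * A.det := by
  set L : Matrix (Fin n) (Fin n) ℝ := Matrix.of fun j i => if i ≤ j then 1 else 0 with hL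
  have hLdet : L.det = 1 := by
    rw [Matrix.det_of_isLowerTriangular]
    · simp [L]
    · intro i j hij
      have : i < j := hij
      simp [L, this]
  have h : (Matrix.of fun j => A fun i => if π i ≤ j then 1 else 0) =
      L.submatrix id π * (LinearMap.toMatrix' (A : (Fin n → ℝ) →ₗ[ℝ] (Fin n → ℝ))).transpose := by
    ext j i
    have := congrFun (LinearMap.toMatrix'_mulVec (A : (Fin n → ℝ) →ₗ[ℝ] (Fin n → ℝ))
      (fun i => if π i ≤ j then 1 else 0)) i
    simp only [Matrix.of_apply, Matrix.mul_apply, Matrix.transpose_apply]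
    rw [← ContinuousLinearMap.coe_coe, ← this]
    simp [Matrix.mulVec, dotProduct, L]
  rw [h, Matrix.det_mul, Matrix.det_permute', hLdet, Matrix.det_transpose,
    LinearMap.det_toMatrix', mul_one]

variable {ι : Type*} [Fintype ι]

lemma continuous_simplexAvg {φ : (ι → ℝ) → ℝ} (hφ : Continuous φ) :
    Continuous fun q : (ι → ℝ) × (ι → ι → ℝ) => simplexAvg φ q.1 q.2 := by
  unfold simplexAvg
  refine continuous_parametric_integral_of_continuous ?_ isCompact_cornerSimplex
  fun_prop

lemma simplexAvg_const (φ : (ι → ℝ) → ℝ) (a : ι → ℝ) :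
    simplexAvg φ a (fun _ => a) = (volume (cornerSimplex ι)).toReal * φ a := by
  simp [simplexAvg, Measure.real]

lemma abs_simplexAvg_le {φ : (ι → ℝ) → ℝ} {s : Set (ι → ℝ)} (hs : Convex ℝ s) {C : ℝ}
    (hC : ∀ y ∈ s, |φ y| ≤ C) {a : ι → ℝ} (ha : a ∈ s) {z : ι → ι → ℝ} (hz : ∀ j, z j ∈ s) :
    |simplexAvg φ a z| ≤ C := by
  have hC0 : 0 ≤ C := (abs_nonneg _).trans (hC a ha)
  have h := norm_setIntegral_le_of_norm_le_const (μ := volume) (s := cornerSimplex ι)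
    (f := fun t => φ (a + ∑ j, t j • (z j - a))) (C := C)
    (volume_cornerSimplex_le_one.trans_lt ENNReal.one_lt_top) (fun t ht => ?_)
  · refine h.trans (mul_le_of_le_one_right hC0 ?_)
    exact ENNReal.toReal_le_of_le_ofReal zero_le_one (by simpa using volume_cornerSimplex_le_one)
  · refine hC _ ?_
    rw [simplexAvg_arg_eq]
    have := hs.sum_mem (t := Finset.univ) (w := fun o : Option ι => o.elim (1 - ∑ j, t j) t)
      (z := fun o => o.elim a z) ?_ ?_ ?_
    · simpa [Fintype.sum_option] using this
    · rintro (_ | i) _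
      · simpa using ht.2
      · exact ht.1 i
    · simp [Fintype.sum_option]
    · rintro (_ | i) _
      · exact ha
      · exact hz i

lemma simplexIntegral_eq_pow_mul [DecidableEq ι] (φ : (ι → ℝ) → ℝ) (a : ι → ℝ) (z : ι → ι → ℝ)
    {h : ℝ} (hh : h ≠ 0) : simplexIntegral φ a z = h ^ Fintype.card ι *
      ((Matrix.of fun j => h⁻¹ • (z j - a)).det * simplexAvg φ a z) := by
  unfold simplexIntegral
  rw [← mul_assoc, ← Matrix.det_smul]
  congr 2
  ext i j
  simp [hh]

end Limit

section PointwiseLimit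

variable {n : ℕ}

lemma latticePoint_cubeVertex_sub (h : ℝ) (m : Fin n → ℤ) (π : Equiv.Perm (Fin n)) (j : Fin n) :
    latticePoint h (cubeVertex m π j) - latticePoint h m =
      h • fun i => if π i ≤ j then (1 : ℝ) else 0 := by
  ext i
  simp only [latticePoint, cubeVertex, Pi.sub_apply, Pi.smul_apply, smul_eq_mul]
  split_ifs <;> push_cast <;> ring

lemma tendsto_cubeIntegral_div {φ : (Fin n → ℝ) → ℝ} (hφ : Continuous φ)
    {f : (Fin n → ℝ) → Fin n → ℝ} {A : (Fin n → ℝ) →L[ℝ] (Fin n → ℝ)} {x : Fin n → ℝ}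
    (hf : HasStrictFDerivAt f A x) {h : ℕ → ℝ} (hpos : ∀ k, 0 < h k)
    (hlim : Filter.Tendsto h Filter.atTop (nhds 0)) {m : ℕ → Fin n → ℤ}
    (hm : ∀ k, x ∈ latticeCube (h k) (m k)) :
    Filter.Tendsto (fun k => (h k ^ n)⁻¹ * cubeIntegral φ (f ∘ latticePoint (h k)) (m k))
      Filter.atTop (nhds (n.factorial * (volume (cornerSimplex (Fin n))).toReal *
        (φ (f x) * A.det))) := by
  have hP : ∀ v : ℕ → Fin n → ℤ, (∀ k, IsCubeVertex (m k) (v k)) →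
      Filter.Tendsto (fun k => latticePoint (h k) (v k)) Filter.atTop (nhds x) := by
    intro v hv
    rw [tendsto_iff_norm_sub_tendsto_zero]
    exact squeeze_zero (fun k => norm_nonneg _) (fun k => norm_sub_le_of_mem_latticeCube
      (hpos k).le (latticePoint_mem_latticeCube (hpos k).le (hv k)) (hm k)) hlim
  have hP0 := hP m fun k => isCubeVertex_self _
  have hPj := fun π j => hP (fun k => cubeVertex (m k) π j) fun k => isCubeVertex_cubeVertex _ π j
  have hQ : ∀ (π : Equiv.Perm (Fin n)) (j : Fin n), Filter.Tendsto (fun k => (h k)⁻¹ •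
      (f (latticePoint (h k) (cubeVertex (m k) π j)) - f (latticePoint (h k) (m k))))
      Filter.atTop (nhds (A fun i => if π i ≤ j then 1 else 0)) := by
    intro π j
    have h1 := hf.isLittleO.comp_tendsto ((hPj π j).prodMk_nhds hP0)
    simp only [Function.comp_def, latticePoint_cubeVertex_sub, map_smul] at h1
    have h2 : (fun k => h k • fun i => if π i ≤ j then (1 : ℝ) else 0) =O[Filter.atTop] h :=
      Asymptotics.IsBigO.of_bound ‖fun i => if π i ≤ j then (1 : ℝ) else 0‖
        (Filter.Eventually.of_forall fun k => by rw [norm_smul, mul_comm])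
    have h3 := (h1.trans_isBigO h2).tendsto_inv_smul_nhds_zero
    have h4 := h3.add_const (A fun i => if π i ≤ j then 1 else 0)
    rw [zero_add] at h4
    refine h4.congr fun k => ?_
    rw [smul_sub, smul_smul, inv_mul_cancel₀ (hpos k).ne', one_smul, sub_add_cancel]
  have hfc := hf.continuousAt.tendsto
  have hterm : ∀ π : Equiv.Perm (Fin n), Filter.Tendsto (fun k => ((Equiv.Perm.sign π : ℤ) : ℝ) *
      ((Matrix.of fun j => (h k)⁻¹ • (f (latticePoint (h k) (cubeVertex (m k) π j)) -
        f (latticePoint (h k) (m k)))).det * simplexAvg φ (f (latticePoint (h k) (m k)))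
          fun j => f (latticePoint (h k) (cubeVertex (m k) π j))))
      Filter.atTop (nhds ((volume (cornerSimplex (Fin n))).toReal * (φ (f x) * A.det))) := by
    intro π
    have h1 := ((continuous_id (X := Matrix (Fin n) (Fin n) ℝ)).matrix_det.tendsto _).comp
      (tendsto_pi_nhds.mpr (hQ π))
    have h2 := ((continuous_simplexAvg hφ).tendsto (f x, fun _ : Fin n => f x)).comp
      ((hfc.comp hP0).prodMk_nhds (tendsto_pi_nhds.mpr fun j => hfc.comp (hPj π j)))
    have h3 := (h1.mul h2).const_mul ((Equiv.Perm.sign π : ℤ) : ℝ)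
    have h4 : ((Equiv.Perm.sign π : ℤ) : ℝ) * ((Equiv.Perm.sign π : ℤ) : ℝ) = 1 := by
      rw [← abs_mul_abs_self, abs_sign_cast, one_mul]
    have h5 : (volume (cornerSimplex (Fin n))).toReal * (φ (f x) * A.det) =
        ((Equiv.Perm.sign π : ℤ) : ℝ) * ((Matrix.of fun j => A fun i => if π i ≤ j then 1 else 0).det
          * simplexAvg φ (f x) fun _ => f x) := by
      rw [det_of_apply_permChain, simplexAvg_const]
      linear_combination (-(volume (cornerSimplex (Fin n))).toReal * φ (f x) * A.det) * h4
    rw [h5]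
    exact h3
  have hsum := tendsto_finsetSum Finset.univ fun π _ => hterm π
  rw [Finset.sum_const, Finset.card_univ, Fintype.card_perm, Fintype.card_fin, nsmul_eq_mul,
    ← mul_assoc] at hsum
  refine hsum.congr fun k => ?_
  rw [cubeIntegral, Finset.mul_sum]
  refine Finset.sum_congr rfl fun π _ => ?_
  rw [simplexIntegral_eq_pow_mul φ _ _ (hpos k).ne', Fintype.card_fin]
  have := (pow_pos (hpos k) n).ne'
  simp only [Function.comp]
  field_simp

end PointwiseLimit

section IntegralLimit

variable {n : ℕ}

/-- The index of the half-open lattice cube of mesh `h` that contains `x`. -/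
noncomputable def floorIndex (h : ℝ) (x : Fin n → ℝ) : Fin n → ℤ := fun i => ⌊x i / h⌋

lemma mem_latticeCube_floorIndex {h : ℝ} (hh : 0 < h) (x : Fin n → ℝ) :
    x ∈ latticeCube h (floorIndex h x) := by
  intro i
  have h1 := Int.floor_le (x i / h)
  have h2 := (Int.lt_floor_add_one (x i / h)).le
  rw [le_div_iff₀ hh] at h1
  rw [div_le_iff₀ hh] at h2
  simp only [floorIndex]
  constructor <;> linarith

lemma floorIndex_preimage_singleton {h : ℝ} (hh : 0 < h) (m : Fin n → ℤ) :
    floorIndex h ⁻¹' {m} = Set.univ.pi fun i => Set.Ico (h * m i) (h * m i + h) := by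
  ext x
  simp only [Set.mem_preimage, Set.mem_singleton_iff, funext_iff, floorIndex, Int.floor_eq_iff,
    Set.mem_pi, Set.mem_univ, true_imp_iff, Set.mem_Ico, le_div_iff₀ hh, div_lt_iff₀ hh]
  refine forall_congr' fun i => ?_
  rw [mul_comm, add_mul, one_mul, mul_comm]

lemma measurable_floorIndex (h : ℝ) : Measurable (floorIndex h : (Fin n → ℝ) → Fin n → ℤ) :=
  by
  refine measurable_pi_lambda _ fun i => Int.measurable_floor.comp ?_
  fun_prop

lemma integral_comp_floorIndex {h : ℝ} (hh : 0 < h) (A : Finset (Fin n → ℤ))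
    (c : (Fin n → ℤ) → ℝ) :
    ∫ x : Fin n → ℝ, (A : Set (Fin n → ℤ)).indicator (fun m => (h ^ n)⁻¹ * c m) (floorIndex h x) =
      ∑ m ∈ A, c m := by
  have hmeas : ∀ m : Fin n → ℤ, MeasurableSet (floorIndex h ⁻¹' {m}) := fun m =>
    measurable_floorIndex h (measurableSet_singleton m)
  have hvol : ∀ m : Fin n → ℤ, volume (floorIndex h ⁻¹' {m}) = ENNReal.ofReal (h ^ n) := by
    intro m
    rw [floorIndex_preimage_singleton hh, Real.volume_pi_Ico]
    simp [ENNReal.ofReal_pow hh.le]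
  have heq : ∀ x : Fin n → ℝ,
      (A : Set (Fin n → ℤ)).indicator (fun m => (h ^ n)⁻¹ * c m) (floorIndex h x) =
        ∑ m ∈ A, (floorIndex h ⁻¹' {m}).indicator (fun _ => (h ^ n)⁻¹ * c m) x := by
    intro x
    have : ∀ m, (floorIndex h ⁻¹' {m}).indicator (fun _ => (h ^ n)⁻¹ * c m) x =
        if floorIndex h x = m then (h ^ n)⁻¹ * c m else 0 := fun m => by
      by_cases hm : floorIndex h x = m <;> simp [hm]
    simp only [this, Finset.sum_ite_eq, Set.indicator_apply, Finset.mem_coe]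
  simp only [heq]
  rw [integral_finsetSum]
  · refine Finset.sum_congr rfl fun m _ => ?_
    rw [integral_indicator_const _ (hmeas m), Measure.real, hvol m,
      ENNReal.toReal_ofReal (pow_nonneg hh.le n), smul_eq_mul,
      mul_inv_cancel_left₀ (pow_ne_zero n hh.ne')]
  · intro m _
    exact (integrable_indicator_iff (hmeas m)).mpr
      (integrableOn_const (by rw [hvol m]; exact ENNReal.ofReal_ne_top))

lemma abs_cubeIntegral_div_le {φ : (Fin n → ℝ) → ℝ} {f : (Fin n → ℝ) → Fin n → ℝ}
    {h L C : ℝ} (hh : 0 < h) {m : Fin n → ℤ} {s : Set (Fin n → ℝ)} (hs : Convex ℝ s)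
    (hC : ∀ y ∈ s, |φ y| ≤ C) (hfs : ∀ x ∈ latticeCube h m, f x ∈ s)
    (hL : ∀ x ∈ latticeCube h m, ∀ y ∈ latticeCube h m, ‖f x - f y‖ ≤ L * ‖x - y‖) (hL0 : 0 ≤ L) :
    |(h ^ n)⁻¹ * cubeIntegral φ (f ∘ latticePoint h) m| ≤
      n.factorial * (n.factorial * L ^ n * C) := by
  have hm := latticePoint_mem_latticeCube hh.le (isCubeVertex_self m)
  have hv := fun π j => latticePoint_mem_latticeCube hh.le (isCubeVertex_cubeVertex m π j)
  have hpow := (pow_pos hh n).ne'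
  rw [cubeIntegral, Finset.mul_sum]
  refine (Finset.abs_sum_le_sum_abs _ _).trans ?_
  refine (Finset.sum_le_card_nsmul _ _ _ fun π _ => ?_).trans_eq
    (by rw [Finset.card_univ, Fintype.card_perm, Fintype.card_fin, nsmul_eq_mul])
  rw [simplexIntegral_eq_pow_mul φ _ _ hh.ne', Fintype.card_fin, mul_left_comm,
    inv_mul_cancel_left₀ hpow, abs_mul, abs_sign_cast, one_mul, abs_mul]
  refine mul_le_mul ?_ (abs_simplexAvg_le hs hC (hfs _ hm) fun j => hfs _ (hv π j))
    (abs_nonneg _) (by positivity)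
  have := Matrix.det_le (A := Matrix.of fun j => h⁻¹ • ((f ∘ latticePoint h) (cubeVertex m π j) -
    (f ∘ latticePoint h) m)) (abv := AbsoluteValue.abs) (x := L) (fun i j => ?_)
  · simpa using this
  · refine (norm_le_pi_norm (h⁻¹ • ((f ∘ latticePoint h) (cubeVertex m π i) -
      (f ∘ latticePoint h) m)) j).trans ?_
    rw [norm_smul, norm_inv, Real.norm_of_nonneg hh.le, inv_mul_le_iff₀ hh, mul_comm]
    exact (hL _ (hv π i) _ hm).trans
      (mul_le_mul_of_nonneg_left (norm_sub_le_of_mem_latticeCube hh.le (hv π i) hm) hL0)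

lemma exists_norm_image_sub_le {E F : Type*} [NormedAddCommGroup E] [NormedSpace ℝ E]
    [NormedAddCommGroup F] [NormedSpace ℝ F] [ProperSpace E]
    {f : E → F} (hf : ContDiff ℝ 1 f) {U : Set E} (hU : Bornology.IsBounded U) :
    ∃ L B : ℝ, 0 ≤ L ∧ (∀ x ∈ U, ∀ y ∈ U, ‖f x - f y‖ ≤ L * ‖x - y‖) ∧ ∀ x ∈ U, ‖f x‖ ≤ B := by
  obtain ⟨R, hR⟩ := hU.subset_closedBall 0
  have hK := isCompact_closedBall (0 : E) R
  obtain ⟨L, hL⟩ := hK.exists_bound_of_continuousOn (hf.continuous_fderiv one_ne_zero).continuousOn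
  obtain ⟨B, hB⟩ := hK.exists_bound_of_continuousOn hf.continuous.continuousOn
  refine ⟨max L 0, B, le_max_right _ _, fun x hx y hy => ?_, fun x hx => hB x (hR hx)⟩
  exact (convex_closedBall (0 : E) R).norm_image_sub_le_of_norm_fderiv_le
    (fun z _ => hf.differentiable one_ne_zero z) (fun z hz => (hL z hz).trans (le_max_left _ _))
    (hR hy) (hR hx)

lemma tendsto_sum_cubeIntegral {φ : (Fin n → ℝ) → ℝ} (hφ : Continuous φ)
    {f : (Fin n → ℝ) → Fin n → ℝ} (hf : ContDiff ℝ 1 f) {U : Set (Fin n → ℝ)} (hUo : IsOpen U)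
    (hUb : Bornology.IsBounded U) {h : ℕ → ℝ} (hpos : ∀ k, 0 < h k)
    (hlim : Filter.Tendsto h Filter.atTop (nhds 0)) {A : ℕ → Finset (Fin n → ℤ)}
    (hA : ∀ k m, m ∈ A k ↔ latticeCube (h k) m ⊆ U) :
    Filter.Tendsto (fun k => ∑ m ∈ A k, cubeIntegral φ (f ∘ latticePoint (h k)) m) Filter.atTop
      (nhds (n.factorial * (volume (cornerSimplex (Fin n))).toReal *
        ∫ x in U, φ (f x) * (fderiv ℝ f x).det)) := by
  obtain ⟨L, B, hL0, hL, hB⟩ := exists_norm_image_sub_le hf hUb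
  obtain ⟨C, hC⟩ := (isCompact_closedBall (0 : Fin n → ℝ) B).exists_bound_of_continuousOn
    hφ.continuousOn
  have hmem := fun k x => mem_latticeCube_floorIndex (n := n) (hpos k) x
  rw [← integral_const_mul, ← integral_indicator hUo.measurableSet]
  simp only [← fun k => integral_comp_floorIndex (hpos k) (A k)
    (cubeIntegral φ (f ∘ latticePoint (h k)))]
  refine tendsto_integral_of_dominated_convergence
    (U.indicator fun _ => n.factorial * (n.factorial * L ^ n * C)) (fun k => ?_) ?_ (fun k => ?_) ?_
  · have : Measurable ((A k : Set (Fin n → ℤ)).indicator fun m =>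
        (h k ^ n)⁻¹ * cubeIntegral φ (f ∘ latticePoint (h k)) m) := measurable_of_countable _
    exact (this.comp (measurable_floorIndex (h k))).aestronglyMeasurable
  · exact (integrable_indicator_iff hUo.measurableSet).mpr
      (integrableOn_const hUb.measure_lt_top.ne)
  · refine Filter.Eventually.of_forall fun x => ?_
    by_cases hx : floorIndex (h k) x ∈ A k
    · have hsub := (hA k _).mp hx
      rw [Set.indicator_of_mem (Finset.mem_coe.mpr hx), Set.indicator_of_mem (hsub (hmem k x))]
      exact abs_cubeIntegral_div_le (hpos k) (convex_closedBall 0 B) hC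
        (fun y hy => by simpa using hB y (hsub hy))
        (fun y hy z hz => hL y (hsub hy) z (hsub hz)) hL0
    · rw [Set.indicator_of_notMem (by simpa using hx), norm_zero]
      refine Set.indicator_nonneg (fun y hy => ?_) x
      have := (norm_nonneg _).trans (hC (f y) (by simpa using hB y hy))
      positivity
  · refine Filter.Eventually.of_forall fun x => ?_
    by_cases hx : x ∈ U
    · rw [Set.indicator_of_mem hx]
      refine (tendsto_cubeIntegral_div hφ (hf.contDiffAt.hasStrictFDerivAt one_ne_zero) hpos hlim
        fun k => hmem k x).congr' ?_
      obtain ⟨ε, hε, hball⟩ := Metric.isOpen_iff.mp hUo x hx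
      filter_upwards [hlim.eventually (gt_mem_nhds hε)] with k hk
      rw [Set.indicator_of_mem]
      refine Finset.mem_coe.mpr ((hA k _).mpr fun y hy => hball ?_)
      rw [Metric.mem_ball, dist_eq_norm]
      exact (norm_sub_le_of_mem_latticeCube (hpos k).le hy (hmem k x)).trans_lt hk
    · rw [Set.indicator_of_notMem hx]
      refine tendsto_const_nhds.congr fun k => (Set.indicator_of_notMem ?_ _).symm
      exact fun h' => hx ((hA k _).mp h' (hmem k x))

end IntegralLimit

section SupNorm

lemma rpow_factorial_mul_pow {n : ℕ} {M t p : ℝ} (hM : 0 ≤ M) (ht : 0 ≤ t) :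
    ((n.factorial : ℝ) * (M * t) ^ n) ^ (1 / p) =
      (n.factorial : ℝ) ^ (1 / p) * M ^ ((n : ℝ) / p) * t ^ ((n : ℝ) / p) := by
  rw [mul_pow, ← mul_assoc, Real.mul_rpow (by positivity) (by positivity),
    Real.mul_rpow (by positivity) (by positivity), ← Real.rpow_natCast, ← Real.rpow_natCast,
    ← Real.rpow_mul hM, ← Real.rpow_mul ht, mul_one_div]

/-- If consecutive differences are dominated by a geometric sequence, the limit is bounded. -/
lemma abs_le_of_tendsto_of_geometric {K : ℕ → ℝ} {l a b q : ℝ} (hq0 : 0 ≤ q) (hq1 : q < 1)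
    (hb : 0 ≤ b) (h0 : |K 0| ≤ a) (hK : ∀ k, |K (k + 1) - K k| ≤ b * q ^ (k + 1))
    (hl : Filter.Tendsto K Filter.atTop (nhds l)) : |l| ≤ a + b * (q / (1 - q)) := by
  have hq : 0 < 1 - q := by linarith
  have hmain : ∀ k, |K k| ≤ a + b * (q / (1 - q)) * (1 - q ^ k) := by
    intro k
    induction k with
    | zero => simpa using h0
    | succ k ih =>
      have h1 : |K (k + 1)| ≤ |K k| + |K (k + 1) - K k| := by
        have := abs_add_le (K k) (K (k + 1) - K k)
        rwa [add_sub_cancel] at this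
      refine h1.trans ((add_le_add ih (hK k)).trans_eq ?_)
      field_simp
      ring
  refine le_of_tendsto hl.abs (Filter.Eventually.of_forall fun k => (hmain k).trans ?_)
  have : 0 ≤ b * (q / (1 - q)) := by positivity
  have := pow_nonneg hq0 k
  nlinarith

/-- The degree bound for the sup norm. -/
theorem exists_abs_integral_comp_mul_det_le_pi {n : ℕ} (hn : n ≠ 0) {α d p p' : ℝ}
    (hα : 0 < α) (hd : 0 < d)
    (hp : 1 < p) (hp2 : p < n * α / d) (hp' : p' = p / (p - 1))
    {U : Set (Fin n → ℝ)} (hUo : IsOpen U) (hUb : Bornology.IsBounded U) {C_U : ℝ}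
    (hCU : 0 ≤ C_U)
    (hcover : ∀ r ∈ Set.Ioc (0 : ℝ) 1, ∃ S : Finset (Fin n → ℝ),
      (S.card : ℝ) ≤ C_U * r ^ (-d) ∧ frontier U ⊆ ⋃ c ∈ S, Metric.closedBall c r) :
    ∃ C : ℝ, 0 < C ∧ ∀ f : (Fin n → ℝ) → Fin n → ℝ, ContDiff ℝ 1 f →
      ∀ φ : (Fin n → ℝ) → ℝ, ContDiff ℝ 1 φ → eLpNorm φ (ENNReal.ofReal p') volume < ⊤ →
      ∀ M : ℝ, 0 ≤ M → (∀ x ∈ U, ∀ y ∈ U, ‖f x - f y‖ ≤ M * ‖x - y‖ ^ α) →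
        |∫ x in U, φ (f x) * (fderiv ℝ f x).det| ≤
          C * (eLpNorm φ (ENNReal.ofReal p') volume).toReal * M ^ ((n : ℝ) / p) := by
  have hp0 : 0 < p := by linarith
  set h : ℕ → ℝ := fun k => (1 / 2) ^ k with hh
  have hpos : ∀ k, 0 < h k := fun k => by positivity
  have hlim : Filter.Tendsto h Filter.atTop (nhds 0) :=
    tendsto_pow_atTop_nhds_zero_of_lt_one (by norm_num) (by norm_num)
  have hself : ∀ k (m : Fin n → ℤ), latticePoint (h k) m ∈ latticeCube (h k) m := fun k m =>
    latticePoint_mem_latticeCube (hpos k).le (isCubeVertex_self m)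
  have hfinA : ∀ k, {m : Fin n → ℤ | latticeCube (h k) m ⊆ U}.Finite := fun k =>
    (finite_latticePoint_mem hUb (hpos k)).subset fun m hm => hm (hself k m)
  set A : ℕ → Finset (Fin n → ℤ) := fun k => (hfinA k).toFinset with hAdef
  have hA : ∀ k m, m ∈ A k ↔ latticeCube (h k) m ⊆ U := fun k m => by simp [hAdef]
  set q : ℝ := (1 / 2) ^ (α * (n / p) - d) with hq
  have hexp : 0 < α * (n / p) - d := by
    rw [lt_div_iff₀ hd] at hp2
    rw [sub_pos, mul_div_assoc', lt_div_iff₀ hp0]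
    linarith
  have hq0 : 0 ≤ q := by positivity
  have hq1 : q < 1 := Real.rpow_lt_one (by norm_num) (by norm_num) hexp
  have hq1' : 0 < 1 - q := by linarith
  set v := (volume (cornerSimplex (Fin n))).toReal with hv
  have hvpos : 0 < v := ENNReal.toReal_pos volume_cornerSimplex_pos.ne'
    (volume_cornerSimplex_le_one.trans_lt ENNReal.one_lt_top).ne
  set c : ℝ := n.factorial * (n.factorial : ℝ) ^ (1 / p) with hc
  set C₁ : ℝ := 2 * (9 ^ n * C_U) * (c * 2 ^ (α * (n / p))) with hC₁
  have hC₁0 : 0 ≤ C₁ := by positivity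
  have hfac : (0 : ℝ) < n.factorial * v := by positivity
  have hCpos : 0 < (A 0).card * c + C₁ * (q / (1 - q)) + 1 := by positivity
  refine ⟨((A 0).card * c + C₁ * (q / (1 - q)) + 1) / (n.factorial * v), div_pos hCpos hfac, ?_⟩
  intro f hf φ hφ hfin M hM hfM
  set Φ := (eLpNorm φ (ENNReal.ofReal p') volume).toReal with hΦ
  have hΦ0 : 0 ≤ Φ := ENNReal.toReal_nonneg
  set P := M ^ ((n : ℝ) / p) with hP
  have hP0 : 0 ≤ P := by positivity
  set K : ℕ → ℝ := fun k => ∑ m ∈ A k, cubeIntegral φ (f ∘ latticePoint (h k)) m with hK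
  have hKlim : Filter.Tendsto K Filter.atTop _ :=
    tendsto_sum_cubeIntegral hφ.continuous hf hUo hUb hpos hlim hA
  have hK0 : |K 0| ≤ (A 0).card * c * Φ * P := by
    refine (Finset.abs_sum_le_sum_abs _ _).trans ?_
    refine (Finset.sum_le_card_nsmul _ _ (c * Φ * P) fun m hm => ?_).trans_eq
      (by rw [nsmul_eq_mul]; ring)
    have hsub := (hA 0 m).mp hm
    refine (abs_cubeIntegral_le hφ.continuous hp hp' hfin (R := M * 1) fun v hv => ?_).trans_eq ?_
    · have hmem := latticePoint_mem_latticeCube (hpos 0).le hv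
      refine (hfM _ (hsub hmem) _ (hsub (hself 0 m))).trans ?_
      refine mul_le_mul_of_nonneg_left (Real.rpow_le_one (norm_nonneg _) ?_ hα.le) hM
      simpa [hh] using norm_sub_le_of_mem_latticeCube (hpos 0).le hmem (hself 0 m)
    · rw [rpow_factorial_mul_pow hM zero_le_one, Real.one_rpow]
      ring
  have hKstep : ∀ k, |K (k + 1) - K k| ≤ C₁ * Φ * P * q ^ (k + 1) := by
    intro k
    obtain ⟨N, rfl⟩ : ∃ N, n = N + 1 := Nat.exists_eq_succ_of_ne_zero hn
    have hle : h (k + 1) ≤ 1 := pow_le_one₀ (by norm_num) (by norm_num)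
    obtain ⟨S, hScard, hS⟩ := hcover (h (k + 1)) ⟨hpos _, hle⟩
    have h2 : 2 * h (k + 1) = h k := by simp only [hh, pow_succ]; ring
    have hmain := abs_sum_cubeIntegral_sub_le hφ hα hp hp' hfin (hpos (k + 1)) hM hfM hScard hS
      (A := A k) (A' := A (k + 1)) (fun m => by rw [h2]; exact hA k m) (hA (k + 1))
    rw [h2] at hmain
    refine hmain.trans_eq ?_
    rw [← h2, rpow_factorial_mul_pow hM (by have := hpos (k + 1); positivity), ← Real.rpow_mul
      (by have := hpos (k + 1); positivity), Real.mul_rpow zero_le_two (hpos _).le]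
    have hqk : q ^ (k + 1) = h (k + 1) ^ (α * ((N + 1 : ℕ) / p)) * h (k + 1) ^ (-d) := by
      rw [← Real.rpow_add (hpos _), ← sub_eq_add_neg, hq, ← Real.rpow_natCast,
        show h (k + 1) = (1 / 2) ^ ((k + 1 : ℕ) : ℝ) from (Real.rpow_natCast _ _).symm,
        ← Real.rpow_mul (by norm_num), ← Real.rpow_mul (by norm_num), mul_comm]
    rw [hqk, hC₁, hc, hP, hΦ]
    ring
  have hfinal := abs_le_of_tendsto_of_geometric hq0 hq1 (by positivity) hK0 hKstep hKlim
  rw [abs_mul, abs_of_pos hfac] at hfinal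
  rw [div_mul_eq_mul_div, div_mul_eq_mul_div, le_div_iff₀ hfac, mul_comm]
  refine hfinal.trans ?_
  have : 0 ≤ Φ * P := by positivity
  calc _ = ((A 0).card * c + C₁ * (q / (1 - q))) * (Φ * P) := by ring
    _ ≤ ((A 0).card * c + C₁ * (q / (1 - q)) + 1) * (Φ * P) :=
      mul_le_mul_of_nonneg_right (by linarith) this
    _ = _ := by ring

end SupNorm

section Euclidean

lemma holderNormOn_nonneg {E F : Type*} [NormedAddCommGroup E] [NormedAddCommGroup F]
    (a : ℝ) (A : Set E) (f : E → F) : 0 ≤ holderNormOn a A f := by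
  refine add_nonneg (Real.sSup_nonneg ?_) (Real.sSup_nonneg ?_)
  · rintro _ ⟨x, -, rfl⟩
    exact norm_nonneg _
  · rintro _ ⟨x, -, y, -, -, rfl⟩
    positivity

lemma norm_sub_le_holderNormOn_mul {E F : Type*} [NormedAddCommGroup E] [NormedSpace ℝ E]
    [NormedAddCommGroup F] [NormedSpace ℝ F] [ProperSpace E] {α : ℝ}
    (hα1 : α ≤ 1) {U : Set E} (hU : Bornology.IsBounded U) {u : E → F} (hu : ContDiff ℝ 1 u)
    {x y : E} (hx : x ∈ U) (hy : y ∈ U) : ‖u x - u y‖ ≤ holderNormOn α U u * ‖x - y‖ ^ α := by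
  obtain ⟨L, B, hL0, hL, hB⟩ := exists_norm_image_sub_le hu hU
  rcases eq_or_ne x y with rfl | hxy
  · rw [sub_self, norm_zero]
    exact mul_nonneg (holderNormOn_nonneg _ _ _) (by positivity)
  have hpos : ∀ {x y : E}, x ≠ y → 0 < dist x y := dist_pos.mpr
  have hbdd : BddAbove {c : ℝ | ∃ x ∈ U, ∃ y ∈ U, x ≠ y ∧ c = ‖u x - u y‖ / dist x y ^ α} := by
    refine ⟨L * Metric.diam U ^ (1 - α), ?_⟩
    rintro _ ⟨x, hx, y, hy, hne, rfl⟩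
    rw [div_le_iff₀ (Real.rpow_pos_of_pos (hpos hne) _)]
    calc ‖u x - u y‖ ≤ L * dist x y := by rw [dist_eq_norm]; exact hL x hx y hy
      _ = L * dist x y ^ (1 - α) * dist x y ^ α := by
        rw [mul_assoc, ← Real.rpow_add (hpos hne), sub_add_cancel, Real.rpow_one]
      _ ≤ _ := by
        gcongr
        exact Metric.dist_le_diam_of_mem hU hx hy
  have h1 := le_csSup hbdd ⟨x, hx, y, hy, hxy, rfl⟩
  have h2 : 0 ≤ sSup ((fun x => ‖u x‖) '' U) := Real.sSup_nonneg (by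
    rintro _ ⟨x, -, rfl⟩
    exact norm_nonneg _)
  rw [← dist_eq_norm x y, ← div_le_iff₀ (Real.rpow_pos_of_pos (hpos hxy) _)]
  unfold holderNormOn
  linarith

variable {n : ℕ}

lemma norm_euclideanEquiv_le (x : EuclideanSpace ℝ (Fin n)) :
    ‖EuclideanSpace.equiv (Fin n) ℝ x‖ ≤ ‖x‖ :=
  (pi_norm_le_iff_of_nonneg (norm_nonneg _)).mpr fun i => PiLp.norm_apply_le x i

lemma norm_euclideanEquiv_symm_le (y : Fin n → ℝ) :
    ‖(EuclideanSpace.equiv (Fin n) ℝ).symm y‖ ≤ √n * ‖y‖ := by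
  rw [EuclideanSpace.norm_eq, ← Real.sqrt_sq (norm_nonneg y), ← Real.sqrt_mul (by positivity)]
  refine Real.sqrt_le_sqrt ?_
  refine (Finset.sum_le_card_nsmul _ _ (‖y‖ ^ 2) fun i _ => ?_).trans_eq (by simp)
  exact pow_le_pow_left₀ (norm_nonneg _) (norm_le_pi_norm y i) 2

lemma measurePreserving_euclideanEquiv_symm :
    MeasurePreserving (EuclideanSpace.equiv (Fin n) ℝ).symm volume volume :=
  PiLp.volume_preserving_toLp (Fin n)

lemma det_fderiv_conj {E F : Type*} [NormedAddCommGroup E] [NormedSpace ℝ E]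
    [NormedAddCommGroup F] [NormedSpace ℝ F] (e : E ≃L[ℝ] F) {u : E → E} {y : F}
    (hu : DifferentiableAt ℝ u (e.symm y)) :
    (fderiv ℝ (e ∘ u ∘ e.symm) y).det = (fderiv ℝ u (e.symm y)).det := by
  have h : HasFDerivAt (e ∘ u ∘ e.symm)
      ((e : E →L[ℝ] F) ∘L fderiv ℝ u (e.symm y) ∘L (e.symm : F →L[ℝ] E)) y :=
    e.hasFDerivAt.comp y (hu.hasFDerivAt.comp y e.symm.hasFDerivAt)
  rw [h.fderiv]
  exact LinearMap.det_conj (fderiv ℝ u (e.symm y) : E →ₗ[ℝ] E) e.toLinearEquiv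

end Euclidean

/-- change-of-variables form of Theorem 1.1. Let `nα > d`,
`1 < p < nα/d`, `p'` the conjugate exponent of `p`, and let `U ⊆ ℝⁿ` be open and bounded
whose boundary can be covered by `C_U · r⁻ᵈ` closed balls of radius `r` for each
`r ∈ (0,1]`. Then there is a constant `C` such that for every `C¹` map `u : ℝⁿ → ℝⁿ`
and every smooth `φ` with finite `L^{p'}` norm,
`|∫_U φ(u x) det Du(x) dx| ≤ C ‖φ‖_{L^{p'}} ‖u‖_{C^{0,α}(U)}^{n/p}`. -/
theorem abs_integral_comp_mul_det_le
    (n : ℕ) (hn : 2 ≤ n) (α d p p' : ℝ)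
    (hα0 : 0 < α) (hα1 : α < 1)
    (hd1 : (n : ℝ) - 1 < d) (hd2 : d < n) (hnd : n * α > d)
    (hp1 : 1 < p) (hp2 : p < n * α / d) (hp' : p' = p / (p - 1))
    (U : Set (EuclideanSpace ℝ (Fin n))) (hUopen : IsOpen U) (hUbdd : Bornology.IsBounded U)
    (C_U : ℝ) (hCU : 1 ≤ C_U)
    (hcover : ∀ r ∈ Set.Ioc (0:ℝ) 1,
      ∃ S : Finset (EuclideanSpace ℝ (Fin n)), (S.card : ℝ) ≤ C_U * r ^ (-d) ∧
        frontier U ⊆ ⋃ c ∈ S, Metric.closedBall c r) :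
    ∃ C : ℝ, 0 < C ∧
      ∀ u : EuclideanSpace ℝ (Fin n) → EuclideanSpace ℝ (Fin n), ContDiff ℝ 1 u →
      ∀ φ : EuclideanSpace ℝ (Fin n) → ℝ, ContDiff ℝ (⊤ : ℕ∞) φ →
        eLpNorm φ (ENNReal.ofReal p') volume < ⊤ →
        |∫ x in U, φ (u x) * (fderiv ℝ u x).det ∂volume| ≤
          C * (eLpNorm φ (ENNReal.ofReal p') volume).toReal *
            holderNormOn α U u ^ ((n : ℝ) / p) := by
  classical
  have hn2 : (2 : ℝ) ≤ n := by exact_mod_cast hn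
  have hd0 : 0 < d := by linarith
  set e := EuclideanSpace.equiv (Fin n) ℝ with he
  have hmp : MeasurePreserving e.symm volume volume := measurePreserving_euclideanEquiv_symm
  have hemb : MeasurableEmbedding e.symm := e.symm.toHomeomorph.measurableEmbedding
  have hpre : e.symm ⁻¹' U = e '' U := (e.image_eq_preimage_symm U).symm
  obtain ⟨C, hC0, hC⟩ := exists_abs_integral_comp_mul_det_le_pi (by omega : n ≠ 0) hα0 hd0 hp1 hp2
    hp' (hUopen.preimage e.symm.continuous)
    (hpre ▸ e.lipschitz.isBounded_image hUbdd) (zero_le_one.trans hCU) fun r hr => by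
      obtain ⟨S, hS, hsub⟩ := hcover r hr
      refine ⟨S.image e, le_trans (by exact_mod_cast Finset.card_image_le) hS, fun y hy => ?_⟩
      have hfr : e.symm ⁻¹' frontier U = frontier (e.symm ⁻¹' U) :=
        e.symm.toHomeomorph.preimage_frontier U
      rw [← hfr] at hy
      obtain ⟨c, hcS, hc⟩ := Set.mem_iUnion₂.mp (hsub hy)
      refine Set.mem_iUnion₂.mpr ⟨e c, Finset.mem_image_of_mem e hcS, ?_⟩
      rw [Metric.mem_closedBall, dist_eq_norm] at hc ⊢
      have := norm_euclideanEquiv_le (e.symm y - c)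
      rw [map_sub, ← he, e.apply_symm_apply] at this
      exact this.trans hc
  refine ⟨C * ((√n ^ α) ^ ((n : ℝ) / p)), by positivity, fun u hu φ hφ hfin => ?_⟩
  have hnorm : eLpNorm (φ ∘ e.symm) (ENNReal.ofReal p') volume =
      eLpNorm φ (ENNReal.ofReal p') volume :=
    eLpNorm_comp_measurePreserving hφ.continuous.aestronglyMeasurable hmp
  have hH := holderNormOn_nonneg α U u
  have hmain := hC (e ∘ u ∘ e.symm) (e.contDiff.comp (hu.comp e.symm.contDiff)) (φ ∘ e.symm)
    ((hφ.of_le (by exact_mod_cast le_top)).comp e.symm.contDiff) (hnorm ▸ hfin)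
    (√n ^ α * holderNormOn α U u) (by positivity) fun x hx y hy => by
      have h1 := norm_euclideanEquiv_le (u (e.symm x) - u (e.symm y))
      rw [map_sub] at h1
      refine (h1.trans (norm_sub_le_holderNormOn_mul hα1.le hUbdd hu hx hy)).trans ?_
      rw [mul_comm (√n ^ α), mul_assoc, ← Real.mul_rpow (by positivity) (norm_nonneg _), ← map_sub]
      gcongr
      exact norm_euclideanEquiv_symm_le _
  rw [hnorm, Real.mul_rpow (by positivity) hH] at hmain
  have hint : ∫ y in e.symm ⁻¹' U, (φ ∘ e.symm) ((e ∘ u ∘ e.symm) y) *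
      (fderiv ℝ (e ∘ u ∘ e.symm) y).det = ∫ x in U, φ (u x) * (fderiv ℝ u x).det := by
    rw [← hmp.setIntegral_preimage_emb hemb]
    refine setIntegral_congr_fun (hemb.measurable hUopen.measurableSet) fun y _ => ?_
    simp only [det_fderiv_conj e (hu.differentiable one_ne_zero _), Function.comp,
      e.symm_apply_apply]
  rw [hint] at hmain
  exact hmain.trans_eq (by ring)
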